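/- arXiv:1312.3517 — 4 statements merged into one kernel-verified Lean document; each statement's English description precedes it below -/
import Mathlib

section
/- Let δ ∈ ℝ \ {−1, −2, −3, …}. Then, as v → 0⁺, Σ_{k=1}^∞ k^δ e^{−k v} = Γ(δ+1) v^{−δ−1} + ζ(−δ) + O(v), where Γ is the Gamma function and ζ(−δ) is the value at −δ of the analytically continued Riemann zeta function. -/
open Filter Topology

noncomputable section

/-- The series `∑ k ^ (a - 1) * exp (-k v)` over positive integers `k`. -/
def expPowerSum (a : ℂ) (v : ℝ) : ℂ :=
  ∑' k : ℕ, ((k : ℂ) + 1) ^ (a - 1) * Complex.exp (-(((k : ℂ) + 1) * v))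

/-- The series `expPowerSum a v` minus its singular part `Γ(a) v ^ (-a)` at `v = 0`. -/
def expPowerSumReg (a : ℂ) (v : ℝ) : ℂ :=
  expPowerSum a v - Complex.Gamma a * (v : ℂ) ^ (-a)

lemma norm_natCast_add_one_cpow (k : ℕ) (s : ℂ) : ‖((k : ℂ) + 1) ^ s‖ = ((k : ℝ) + 1) ^ s.re := by
  rw [← Complex.norm_cpow_eq_rpow_re_of_pos (by positivity)]
  push_cast
  rfl

lemma norm_expPowerSum_term (a : ℂ) (v : ℝ) (k : ℕ) :
    ‖((k : ℂ) + 1) ^ (a - 1) * Complex.exp (-(((k : ℂ) + 1) * v))‖ =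
      ((k : ℝ) + 1) ^ (a.re - 1) * Real.exp (-(((k : ℝ) + 1) * v)) := by
  rw [norm_mul, norm_natCast_add_one_cpow, Complex.norm_exp]
  simp

lemma summable_add_one_rpow {p : ℝ} (hp : p < -1) : Summable fun k : ℕ ↦ ((k : ℝ) + 1) ^ p := by
  simpa using (summable_nat_add_iff 1).mpr (Real.summable_nat_rpow.mpr hp)

lemma summable_rpow_mul_exp (p : ℝ) {v : ℝ} (hv : 0 < v) :
    Summable fun k : ℕ ↦ ((k : ℝ) + 1) ^ p * Real.exp (-(((k : ℝ) + 1) * v)) := by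
  have h : Summable fun k : ℕ ↦ (k : ℝ) ^ p * Real.exp (-((k : ℝ) * v)) := by
    refine summable_of_isBigO_nat (Real.summable_nat_rpow.mpr (by norm_num : (-2 : ℝ) < -1)) ?_
    have h1 : (fun x : ℝ ↦ x ^ p * Real.exp (-(x * v))) =O[atTop] fun x ↦ x ^ (-2 : ℝ) := by
      have := (Asymptotics.isBigO_refl (fun x : ℝ ↦ x ^ p) atTop).mul
        (isLittleO_exp_neg_mul_rpow_atTop hv (-2 - p)).isBigO
      refine (this.congr' ?_ ?_)
      · exact .of_forall fun x ↦ by simp [mul_comm]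
      · filter_upwards [eventually_gt_atTop 0] with x hx
        rw [← Real.rpow_add hx]
        ring_nf
    exact h1.comp_tendsto tendsto_natCast_atTop_atTop
  simpa using (summable_nat_add_iff 1).mpr h

lemma differentiable_expPowerSum {v : ℝ} (hv : 0 < v) :
    Differentiable ℂ fun a ↦ expPowerSum a v := by
  intro a
  have hopen : IsOpen {s : ℂ | s.re < a.re + 1} := Complex.continuous_re.isOpen_preimage _ isOpen_Iio
  refine (Complex.differentiableOn_tsum_of_summable_norm
    (summable_rpow_mul_exp a.re hv) (fun k ↦ ?_) hopen fun k s hs ↦ ?_).differentiableAt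
    (hopen.mem_nhds (by simp))
  · have : ((k : ℂ) + 1) ≠ 0 := by exact_mod_cast k.succ_ne_zero
    intro s _
    exact (((differentiableAt_id.sub_const 1).const_cpow (Or.inl this)).mul_const
      _).differentiableWithinAt
  · rw [norm_expPowerSum_term]
    gcongr
    · simp
    · have : s.re < a.re + 1 := hs
      linarith

lemma differentiableAt_expPowerSumReg {v : ℝ} (hv : 0 < v) {a : ℂ} (ha : ∀ m : ℕ, a ≠ -m) :
    DifferentiableAt ℂ (fun a ↦ expPowerSumReg a v) a := by
  have hv' : (v : ℂ) ≠ 0 := by exact_mod_cast hv.ne'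
  exact (differentiable_expPowerSum hv a).sub ((Complex.differentiableAt_Gamma a ha).mul
    (differentiableAt_id.neg.const_cpow (Or.inl hv')))

lemma hasDerivAt_expPowerSum (a : ℂ) {v : ℝ} (hv : 0 < v) :
    HasDerivAt (expPowerSum a) (-expPowerSum (a + 1) v) v := by
  have hv2 : 0 < v / 2 := by positivity
  have hmem : v ∈ Set.Ioi (v / 2) := by simp [hv]
  have key := hasDerivAt_tsum_of_isPreconnected
    (g := fun (k : ℕ) (x : ℝ) ↦ ((k : ℂ) + 1) ^ (a - 1) * Complex.exp (-(((k : ℂ) + 1) * x)))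
    (g' := fun (k : ℕ) (x : ℝ) ↦
      -(((k : ℂ) + 1) ^ (a + 1 - 1) * Complex.exp (-(((k : ℂ) + 1) * x))))
    (summable_rpow_mul_exp a.re hv2) isOpen_Ioi isPreconnected_Ioi
    (fun k x _ ↦ ?_) (fun k x hx ↦ ?_) hmem ?_ hmem
  · rw [tsum_neg] at key
    exact key
  · have hk : ((k : ℂ) + 1) ≠ 0 := by exact_mod_cast k.succ_ne_zero
    have h1 : HasDerivAt (fun x : ℝ ↦ -(((k : ℂ) + 1) * x)) (-(((k : ℂ) + 1) * 1)) x :=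
      ((Complex.ofRealCLM.hasDerivAt (x := x)).const_mul _).neg
    convert! h1.cexp.const_mul (((k : ℂ) + 1) ^ (a - 1)) using 1
    rw [show a + 1 - 1 = a - 1 + 1 by ring, Complex.cpow_add _ _ hk, Complex.cpow_one]
    ring
  · rw [norm_neg, norm_expPowerSum_term]
    have : v / 2 < x := hx
    simp only [Complex.add_re, Complex.one_re, add_sub_cancel_right]
    gcongr
  · refine Summable.of_norm ?_
    simpa only [norm_expPowerSum_term] using summable_rpow_mul_exp (a.re - 1) hv

lemma hasDerivAt_expPowerSumReg {a : ℂ} (ha : a ≠ 0) {v : ℝ} (hv : 0 < v) :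
    HasDerivAt (expPowerSumReg a) (-expPowerSumReg (a + 1) v) v := by
  have h := (hasDerivAt_expPowerSum a hv).sub
    ((hasDerivAt_ofReal_cpow_const hv.ne' (neg_ne_zero.mpr ha)).const_mul (Complex.Gamma a))
  convert! h using 1
  rw [expPowerSumReg, Complex.Gamma_add_one a ha, show -(a + 1) = -a - 1 by ring]
  ring

open MeasureTheory in
lemma integrableOn_cpow_mul_exp {a r : ℂ} (ha : 0 < a.re) (hr : 0 < r.re) :
    IntegrableOn (fun t : ℝ ↦ (t : ℂ) ^ (a - 1) * Complex.exp (-(r * t))) (Set.Ioi 0) := by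
  have hmeas : AEStronglyMeasurable
      (fun t : ℝ ↦ (t : ℂ) ^ (a - 1) * Complex.exp (-(r * t))) (volume.restrict (Set.Ioi 0)) := by
    refine ContinuousOn.aestronglyMeasurable (fun t ht ↦ ?_) measurableSet_Ioi
    refine ContinuousAt.continuousWithinAt (.mul ?_ (by fun_prop))
    exact Complex.continuous_ofReal.continuousAt.cpow continuousAt_const (Or.inl (by simpa using ht))
  refine (integrableOn_rpow_mul_exp_neg_mul_rpow (s := a.re - 1) (by linarith) one_pos hr).mono'
    hmeas ((ae_restrict_mem measurableSet_Ioi).mono fun t ht ↦ ?_)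
  rw [norm_mul, Complex.norm_cpow_eq_rpow_re_of_pos ht, Complex.norm_exp]
  simp

open MeasureTheory in
/-- The Gamma integral with a complex scaling parameter. -/
lemma integral_cpow_mul_exp_neg_mul_Ioi_of_re_pos {a r : ℂ} (ha : 0 < a.re) (hr : 0 < r.re) :
    ∫ t : ℝ in Set.Ioi 0, (t : ℂ) ^ (a - 1) * Complex.exp (-(r * t)) =
      Complex.Gamma a * r ^ (-a) := by
  have hopen : IsOpen {s : ℂ | 0 < s.re} := Complex.continuous_re.isOpen_preimage _ isOpen_Ioi
  have hconv : Convex ℝ {s : ℂ | 0 < s.re} := convex_halfSpace_re_gt 0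
  have hleft : DifferentiableOn ℂ
      (fun s : ℂ ↦ ∫ t : ℝ in Set.Ioi 0, (t : ℂ) ^ (a - 1) * Complex.exp (-(s * t)))
      {s : ℂ | 0 < s.re} := by
    intro s hs
    have hs' : 0 < s.re := hs
    have hnhds : {z : ℂ | s.re / 2 < z.re} ∈ 𝓝 s :=
      (Complex.continuous_re.isOpen_preimage _ isOpen_Ioi).mem_nhds (by simpa using hs')
    have h := hasDerivAt_integral_of_dominated_loc_of_deriv_le
      (μ := volume.restrict (Set.Ioi (0 : ℝ)))
      (F := fun (s : ℂ) (t : ℝ) ↦ (t : ℂ) ^ (a - 1) * Complex.exp (-(s * t)))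
      (F' := fun (s : ℂ) (t : ℝ) ↦ -((t : ℂ) ^ (a + 1 - 1) * Complex.exp (-(s * t))))
      (bound := fun t ↦ t ^ a.re * Real.exp (-(s.re / 2) * t ^ (1 : ℝ))) hnhds
      ?_ (integrableOn_cpow_mul_exp ha hs)
      (integrableOn_cpow_mul_exp (a := a + 1) (by simp; linarith) hs).neg.aestronglyMeasurable
      ?_ (integrableOn_rpow_mul_exp_neg_mul_rpow (by linarith) one_pos (by linarith)) ?_
    · exact h.2.differentiableAt.differentiableWithinAt
    · filter_upwards [hopen.mem_nhds hs] with z hz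
      exact (integrableOn_cpow_mul_exp ha hz).aestronglyMeasurable
    · refine (ae_restrict_mem measurableSet_Ioi).mono fun t ht z hz ↦ ?_
      have ht' : 0 < t := ht
      have hz' : s.re / 2 < z.re := hz
      rw [norm_neg, norm_mul, Complex.norm_cpow_eq_rpow_re_of_pos ht, Complex.norm_exp]
      simp only [add_sub_cancel_right, Complex.neg_re, Complex.mul_re, Complex.ofReal_re,
        Complex.ofReal_im, mul_zero, sub_zero, Real.rpow_one, neg_mul]
      gcongr
    · refine (ae_restrict_mem measurableSet_Ioi).mono fun t ht z _ ↦ ?_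
      have ht' : (t : ℂ) ≠ 0 := by exact_mod_cast (ne_of_gt ht)
      have h1 : HasDerivAt (fun z : ℂ ↦ -(z * t)) (-(1 * t)) z :=
        ((hasDerivAt_id z).mul_const _).neg
      convert! h1.cexp.const_mul ((t : ℂ) ^ (a - 1)) using 1
      rw [show a + 1 - 1 = a - 1 + 1 by ring, Complex.cpow_add _ _ ht', Complex.cpow_one]
      ring
  have hright : DifferentiableOn ℂ (fun s : ℂ ↦ Complex.Gamma a * s ^ (-a)) {s : ℂ | 0 < s.re} :=
    fun s hs ↦ ((differentiableAt_id.cpow (differentiableAt_const _)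
      (Or.inl hs)).const_mul _).differentiableWithinAt
  refine (hleft.analyticOnNhd hopen).eqOn_of_preconnected_of_frequently_eq
    (hright.analyticOnNhd hopen) hconv.isPreconnected (z₀ := 1) (by simp) ?_ hr
  have htend : Tendsto (fun x : ℝ ↦ (x : ℂ)) (𝓝[>] 1) (𝓝[≠] 1) := by
    refine tendsto_nhdsWithin_iff.mpr ⟨?_, ?_⟩
    · exact (Complex.continuous_ofReal.tendsto' 1 1 (by simp)).mono_left nhdsWithin_le_nhds
    · filter_upwards [self_mem_nhdsWithin] with x hx
      have : x ≠ 1 := ne_of_gt hx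
      simpa using this
  refine htend.frequently (Eventually.frequently ?_)
  filter_upwards [self_mem_nhdsWithin] with x hx
  have hx0 : (0 : ℝ) < x := one_pos.trans hx
  rw [Complex.integral_cpow_mul_exp_neg_mul_Ioi ha hx0, one_div, Complex.inv_cpow, Complex.cpow_neg,
    mul_comm]
  rw [Complex.arg_ofReal_of_nonneg hx0.le]
  exact Real.pi_pos.ne

/-- `expPowerSum a v` is a sum over positive integers of this function. -/
def expPowerFun (a : ℂ) (v : ℝ) (x : ℝ) : ℂ :=
  ((max x 0 : ℝ) : ℂ) ^ (a - 1) * Complex.exp (-((v : ℂ) * x))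

lemma expPowerFun_of_pos (a : ℂ) (v : ℝ) {x : ℝ} (hx : 0 < x) :
    expPowerFun a v x = (x : ℂ) ^ (a - 1) * Complex.exp (-((v : ℂ) * x)) := by
  rw [expPowerFun, max_eq_left hx.le]

lemma expPowerFun_of_nonpos {a : ℂ} (ha : 1 < a.re) (v : ℝ) {x : ℝ} (hx : x ≤ 0) :
    expPowerFun a v x = 0 := by
  have : a - 1 ≠ 0 := sub_ne_zero.mpr (by rintro rfl; simp at ha)
  rw [expPowerFun, max_eq_right hx, Complex.ofReal_zero, Complex.zero_cpow this, zero_mul]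

lemma continuous_expPowerFun {a : ℂ} (ha : 1 < a.re) (v : ℝ) : Continuous (expPowerFun a v) := by
  refine Continuous.mul (continuous_iff_continuousAt.mpr fun x ↦ ?_) (by fun_prop)
  have h := Complex.continuousAt_ofReal_cpow (max x 0) (a - 1) (Or.inl (by simpa using ha))
  exact ContinuousAt.comp (g := fun p : ℝ × ℂ ↦ (p.1 : ℂ) ^ p.2) (f := fun x : ℝ ↦ (max x 0, a - 1))
    h (by fun_prop)

lemma expPowerFun_isBigO {a : ℂ} (ha : 1 < a.re) {v : ℝ} (hv : 0 < v) (b : ℝ) :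
    expPowerFun a v =O[cocompact ℝ] fun x ↦ |x| ^ (-b) := by
  refine Asymptotics.IsBigO.mono ?_ cocompact_le_atBot_atTop
  refine Asymptotics.IsBigO.sup ?_ ?_
  · refine Asymptotics.IsBigO.congr' (Asymptotics.isBigO_zero _ _) ?_ .rfl
    filter_upwards [eventually_le_atBot 0] with x hx
    rw [expPowerFun_of_nonpos ha v hx]
  · have := (Asymptotics.isBigO_refl (fun x : ℝ ↦ x ^ (a.re - 1)) atTop).mul
      (isLittleO_exp_neg_mul_rpow_atTop hv (-b - (a.re - 1))).isBigO
    refine Asymptotics.IsBigO.of_norm_left (this.congr' ?_ ?_)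
    · filter_upwards [eventually_gt_atTop 0] with x hx
      rw [expPowerFun_of_pos a v hx, norm_mul, Complex.norm_cpow_eq_rpow_re_of_pos hx,
        Complex.norm_exp]
      simp
    · filter_upwards [eventually_gt_atTop 0] with x hx
      rw [← Real.rpow_add hx, abs_of_pos hx]
      ring_nf

open MeasureTheory FourierTransform in
lemma fourier_expPowerFun {a : ℂ} (ha : 1 < a.re) {v : ℝ} (hv : 0 < v) (w : ℝ) :
    𝓕 (expPowerFun a v) w =
      Complex.Gamma a * ((v : ℂ) + 2 * Real.pi * w * Complex.I) ^ (-a) := by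
  rw [Real.fourier_real_eq_integral_exp_smul,
    ← integral_cpow_mul_exp_neg_mul_Ioi_of_re_pos (by linarith) (by simpa using hv),
    ← setIntegral_eq_integral_of_forall_compl_eq_zero (s := Set.Ioi 0)]
  · refine setIntegral_congr_fun measurableSet_Ioi fun t ht ↦ ?_
    simp only [expPowerFun_of_pos a v ht, smul_eq_mul]
    rw [mul_left_comm, ← Complex.exp_add]
    congr 2
    push_cast
    ring
  · intro x hx
    rw [expPowerFun_of_nonpos ha v (not_lt.mp hx), smul_zero]

lemma norm_cpow_neg_le {a z : ℂ} {c : ℝ} (hc : 0 < c) (ha : 0 ≤ a.re) (hz : c ≤ ‖z‖) :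
    ‖z ^ (-a)‖ ≤ Real.exp (Real.pi * |a.im|) * c ^ (-a.re) := by
  have hz0 : z ≠ 0 := norm_pos_iff.mp (hc.trans_le hz)
  rw [Complex.norm_cpow_of_ne_zero hz0, div_eq_mul_inv, ← Real.exp_neg, mul_comm, Complex.neg_re,
    Complex.neg_im]
  refine mul_le_mul (Real.exp_le_exp.mpr ?_) ?_ (by positivity) (by positivity)
  · calc -(z.arg * -a.im) ≤ |z.arg * a.im| := by rw [mul_neg, neg_neg]; exact le_abs_self _
      _ = |z.arg| * |a.im| := abs_mul _ _
      _ ≤ Real.pi * |a.im| := by gcongr; exact Complex.abs_arg_le_pi z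
  · exact Real.rpow_le_rpow_of_nonpos hc hz (by linarith)

lemma add_one_le_norm_add_mul_I (v : ℝ) (k : ℕ) :
    (k : ℝ) + 1 ≤ ‖(v : ℂ) + 2 * Real.pi * (k + 1) * Complex.I‖ ∧
      (k : ℝ) + 1 ≤ ‖(v : ℂ) - 2 * Real.pi * (k + 1) * Complex.I‖ := by
  have hk : (0 : ℝ) < (k : ℝ) + 1 := by positivity
  have h : (k : ℝ) + 1 ≤ |2 * Real.pi * (k + 1)| := by
    rw [abs_of_pos (by positivity)]
    nlinarith [Real.pi_gt_three]
  constructor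
  · refine h.trans ((le_of_eq ?_).trans (Complex.abs_im_le_norm _))
    simp
  · refine h.trans ((le_of_eq ?_).trans (Complex.abs_im_le_norm _))
    simp

/-- The contribution of the frequencies `k + 1` and `-(k + 1)` to the Poisson summation of
`expPowerSum`. -/
def dualTerm (a : ℂ) (v : ℝ) (k : ℕ) : ℂ :=
  ((v : ℂ) + 2 * Real.pi * (k + 1) * Complex.I) ^ (-a) +
    ((v : ℂ) - 2 * Real.pi * (k + 1) * Complex.I) ^ (-a)

lemma norm_dualTerm_le {a : ℂ} (ha : 0 ≤ a.re) (v : ℝ) (k : ℕ) :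
    ‖dualTerm a v k‖ ≤ 2 * Real.exp (Real.pi * |a.im|) * ((k : ℝ) + 1) ^ (-a.re) := by
  have hk : (0 : ℝ) < (k : ℝ) + 1 := by positivity
  have h1 := norm_cpow_neg_le hk ha (add_one_le_norm_add_mul_I v k).1
  have h2 := norm_cpow_neg_le hk ha (add_one_le_norm_add_mul_I v k).2
  refine (norm_add_le _ _).trans ?_
  linarith

open FourierTransform in
/-- The Lipschitz summation formula. -/
lemma expPowerSumReg_eq_tsum_dualTerm {a : ℂ} (ha : 1 < a.re) {v : ℝ} (hv : 0 < v) :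
    expPowerSumReg a v = Complex.Gamma a * ∑' k, dualTerm a v k := by
  have ha0 : 0 ≤ a.re := by linarith
  have hsum := (summable_add_one_rpow (neg_lt_neg ha)).mul_left (Real.exp (Real.pi * |a.im|))
  have hpos : Summable fun k : ℕ ↦
      ((v : ℂ) + 2 * Real.pi * (k + 1) * Complex.I) ^ (-a) :=
    .of_norm_bounded hsum fun k ↦
      norm_cpow_neg_le (by positivity) ha0 (add_one_le_norm_add_mul_I v k).1
  have hneg : Summable fun k : ℕ ↦
      ((v : ℂ) - 2 * Real.pi * (k + 1) * Complex.I) ^ (-a) :=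
    .of_norm_bounded hsum fun k ↦
      norm_cpow_neg_le (by positivity) ha0 (add_one_le_norm_add_mul_I v k).2
  set g : ℤ → ℂ := fun n ↦ ((v : ℂ) + 2 * Real.pi * n * Complex.I) ^ (-a) with hg
  have hgpos (k : ℕ) : g ((k : ℤ) + 1) = ((v : ℂ) + 2 * Real.pi * (k + 1) * Complex.I) ^ (-a) := by
    simp [hg]
  have hgneg (k : ℕ) : g (-((k : ℤ) + 1)) =
      ((v : ℂ) - 2 * Real.pi * (k + 1) * Complex.I) ^ (-a) := by
    simp only [hg]
    congr 1
    push_cast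
    ring
  have hfourier (n : ℤ) : 𝓕 (expPowerFun a v) n = Complex.Gamma a * g n := by
    simp [fourier_expPowerFun ha hv, hg]
  have hpos' : Summable fun k : ℕ ↦ g ((k : ℤ) + 1) := by simpa only [hgpos] using hpos
  have hneg' : Summable fun k : ℕ ↦ g (-((k : ℤ) + 1)) := by simpa only [hgneg] using hneg
  have hpoisson := Real.tsum_eq_tsum_fourier_of_rpow_decay_of_summable
    (continuous_expPowerFun ha v) one_lt_two (expPowerFun_isBigO ha hv 2)
    (by simpa only [hfourier] using
      (Summable.of_add_one_of_neg_add_one hpos' hneg').mul_left (Complex.Gamma a)) 0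
  have hzero (k : ℕ) : expPowerFun a v ((-((k : ℤ) + 1) : ℤ) : ℝ) = 0 :=
    expPowerFun_of_nonpos ha v (by push_cast; linarith [k.cast_nonneg (α := ℝ)])
  have hterm (k : ℕ) : expPowerFun a v (((k : ℤ) + 1 : ℤ) : ℝ) =
      ((k : ℂ) + 1) ^ (a - 1) * Complex.exp (-(((k : ℂ) + 1) * v)) := by
    rw [expPowerFun_of_pos a v (by push_cast; positivity)]
    push_cast
    rw [mul_comm (v : ℂ)]
  have hleft : ∑' n : ℤ, expPowerFun a v (0 + n) = expPowerSum a v := by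
    simp only [zero_add]
    rw [tsum_of_add_one_of_neg_add_one (f := fun n : ℤ ↦ expPowerFun a v n)]
    · simp only [hzero, hterm, Int.cast_zero, expPowerFun_of_nonpos ha v le_rfl, tsum_zero,
        add_zero]
      rfl
    · simp only [hterm]
      refine Summable.of_norm ?_
      simpa only [norm_expPowerSum_term] using summable_rpow_mul_exp (a.re - 1) hv
    · simp only [hzero]
      exact summable_zero
  have hright : ∑' n : ℤ, 𝓕 (expPowerFun a v) n * fourier n ((0 : ℝ) : UnitAddCircle) =
      Complex.Gamma a * (∑' k, dualTerm a v k + (v : ℂ) ^ (-a)) := by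
    simp only [hfourier, AddCircle.coe_zero, fourier_eval_zero, mul_one, tsum_mul_left]
    rw [tsum_of_add_one_of_neg_add_one hpos' hneg']
    simp only [hgpos, hgneg]
    unfold dualTerm
    rw [hpos.tsum_add hneg]
    simp only [hg, Int.cast_zero, mul_zero, zero_mul, add_zero]
    ring
  rw [hleft, hright] at hpoisson
  rw [expPowerSumReg, hpoisson]
  ring

lemma norm_expPowerSumReg_le {a : ℂ} (ha : 1 < a.re) {v : ℝ} (hv : 0 < v) :
    ‖expPowerSumReg a v‖ ≤ ‖Complex.Gamma a‖ *
      (2 * Real.exp (Real.pi * |a.im|) * ∑' k : ℕ, ((k : ℝ) + 1) ^ (-a.re)) := by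
  rw [expPowerSumReg_eq_tsum_dualTerm ha hv, norm_mul, ← tsum_mul_left]
  gcongr
  exact tsum_of_norm_bounded ((summable_add_one_rpow (neg_lt_neg ha)).mul_left _).hasSum
    fun k ↦ norm_dualTerm_le (by linarith) v k

lemma dualTerm_zero (a : ℂ) (k : ℕ) :
    dualTerm a 0 k = 2 * (2 * Real.pi) ^ (-a) * Complex.cos (Real.pi * a / 2) *
      (1 / ((k : ℂ) + 1) ^ a) := by
  have hk : (0 : ℝ) < (k : ℝ) + 1 := by positivity
  have hpi : (0 : ℝ) < 2 * Real.pi := by positivity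
  have h1 : (2 * Real.pi * (k + 1) : ℂ) = ((2 * Real.pi * (k + 1) : ℝ) : ℂ) := by push_cast; rfl
  have hr : (0 : ℝ) < 2 * Real.pi * (k + 1) := by positivity
  have h2 : (2 * Real.pi * (k + 1) : ℂ) ^ (-a) =
      (2 * Real.pi : ℂ) ^ (-a) * (1 / ((k : ℂ) + 1) ^ a) := by
    have := Complex.mul_cpow_ofReal_nonneg hpi.le hk.le (-a)
    push_cast at this
    rw [this, Complex.cpow_neg ((k : ℂ) + 1), one_div]
  have hmul {x : ℝ} (hx : 0 < x) {z : ℂ} (hz : z ≠ 0) :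
      ((x : ℂ) * z) ^ (-a) = (x : ℂ) ^ (-a) * z ^ (-a) := by
    have hx' : (x : ℂ) ≠ 0 := by exact_mod_cast hx.ne'
    rw [Complex.cpow_def_of_ne_zero (mul_ne_zero hx' hz), Complex.log_ofReal_mul hx hz,
      Complex.ofReal_log hx.le, add_mul, Complex.exp_add, ← Complex.cpow_def_of_ne_zero hx',
      ← Complex.cpow_def_of_ne_zero hz]
  rw [dualTerm, Complex.ofReal_zero, zero_add, zero_sub, ← mul_neg, h1, hmul hr Complex.I_ne_zero,
    hmul hr (neg_ne_zero.mpr Complex.I_ne_zero), ← h1, h2, Complex.cpow_def_of_ne_zero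
    Complex.I_ne_zero, Complex.cpow_def_of_ne_zero (neg_ne_zero.mpr Complex.I_ne_zero),
    Complex.log_I, Complex.log_neg_I, Complex.cos]
  ring_nf

lemma tendsto_expPowerSumReg_of_one_lt_re {a : ℂ} (ha : 1 < a.re) :
    Tendsto (expPowerSumReg a) (𝓝[>] 0) (𝓝 (riemannZeta (1 - a))) := by
  have hzeta : riemannZeta (1 - a) = Complex.Gamma a * ∑' k, dualTerm a 0 k := by
    rw [riemannZeta_one_sub, zeta_eq_tsum_one_div_nat_add_one_cpow ha]
    · simp only [dualTerm_zero, tsum_mul_left]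
      ring
    · rintro n rfl
      simp at ha
      linarith [n.cast_nonneg (α := ℝ)]
    · rintro rfl
      simp at ha
  rw [hzeta]
  have hlim : Tendsto (fun v ↦ ∑' k, dualTerm a v k) (𝓝[>] 0) (𝓝 (∑' k, dualTerm a 0 k)) := by
    refine tendsto_tsum_of_dominated_convergence
      ((summable_add_one_rpow (neg_lt_neg ha)).mul_left _) (fun k ↦ ?_)
      (.of_forall fun v k ↦ norm_dualTerm_le (by linarith) v k)
    have hk : (2 * Real.pi * (k + 1) : ℝ) ≠ 0 := by positivity
    have hcont : ContinuousAt (fun v ↦ dualTerm a v k) 0 := by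
      refine .add (.cpow (by fun_prop) continuousAt_const (.inr ?_))
        (.cpow (by fun_prop) continuousAt_const (.inr ?_)) <;> simpa using hk
    exact hcont.tendsto.mono_left nhdsWithin_le_nhds
  refine (hlim.const_mul (Complex.Gamma a)).congr' ?_
  filter_upwards [self_mem_nhdsWithin] with v hv
  exact (expPowerSumReg_eq_tsum_dualTerm ha hv).symm

section DerivBound

variable {f f' : ℝ → ℂ} {b C : ℝ}

lemma norm_sub_le_of_deriv_bound (hf : ∀ x ∈ Set.Ioo 0 b, HasDerivAt f (f' x) x)
    (hC : ∀ x ∈ Set.Ioo 0 b, ‖f' x‖ ≤ C) {x y : ℝ} (hx : x ∈ Set.Ioo 0 b) (hy : y ∈ Set.Ioo 0 b) :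
    ‖f y - f x‖ ≤ C * |y - x| :=
  (convex_Ioo 0 b).norm_image_sub_le_of_norm_hasDerivWithin_le
    (fun z hz ↦ (hf z hz).hasDerivWithinAt) hC hx hy

lemma exists_tendsto_of_deriv_bound (hb : 0 < b)
    (hf : ∀ x ∈ Set.Ioo 0 b, HasDerivAt f (f' x) x)
    (hC : ∀ x ∈ Set.Ioo 0 b, ‖f' x‖ ≤ C) : ∃ l, Tendsto f (𝓝[>] 0) (𝓝 l) := by
  rw [← cauchy_map_iff_exists_tendsto, Metric.cauchy_iff]
  have hC0 : 0 ≤ C := (norm_nonneg _).trans (hC (b / 2) ⟨by linarith, by linarith⟩)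
  refine ⟨inferInstance, fun ε hε ↦ ?_⟩
  have hδ : 0 < min b (ε / (C + 1)) := lt_min hb (by positivity)
  refine ⟨f '' Set.Ioo 0 (min b (ε / (C + 1))), image_mem_map (Ioo_mem_nhdsGT hδ), ?_⟩
  rintro _ ⟨x, hx, rfl⟩ _ ⟨y, hy, rfl⟩
  have hxy : |x - y| < ε / (C + 1) :=
    (abs_sub_lt_of_nonneg_of_lt hx.1.le hx.2 hy.1.le hy.2).trans_le (min_le_right _ _)
  rw [dist_eq_norm]
  refine (norm_sub_le_of_deriv_bound hf hC ⟨hy.1, hy.2.trans_le (min_le_left _ _)⟩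
    ⟨hx.1, hx.2.trans_le (min_le_left _ _)⟩).trans_lt ?_
  calc C * |x - y| ≤ (C + 1) * |x - y| := by gcongr; linarith
    _ < (C + 1) * (ε / (C + 1)) := by gcongr
    _ = ε := by field_simp

lemma norm_sub_limit_le_of_deriv_bound (hf : ∀ x ∈ Set.Ioo 0 b, HasDerivAt f (f' x) x)
    (hC : ∀ x ∈ Set.Ioo 0 b, ‖f' x‖ ≤ C) {l : ℂ} (hl : Tendsto f (𝓝[>] 0) (𝓝 l)) {v : ℝ}
    (hv : v ∈ Set.Ioo 0 b) : ‖f v - l‖ ≤ C * v := by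
  have hid : Tendsto (fun w : ℝ ↦ C * |v - w|) (𝓝[>] 0) (𝓝 (C * v)) := by
    have : Continuous fun w : ℝ ↦ C * |v - w| := by fun_prop
    exact (this.tendsto' 0 _ (by simp [abs_of_pos hv.1])).mono_left nhdsWithin_le_nhds
  refine le_of_tendsto_of_tendsto (hl.const_sub (f v)).norm hid ?_
  filter_upwards [Ioo_mem_nhdsGT (hv.1.trans hv.2)] with w hw
  exact norm_sub_le_of_deriv_bound hf hC hw hv

end DerivBound

lemma exists_locally_uniform_bound {s : ℂ} (hs : 1 < s.re) :
    ∃ C, ∀ᶠ a in 𝓝 s, ∀ v > 0, ‖expPowerSumReg a v‖ ≤ C := by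
  obtain ⟨p, hp1, hps⟩ := exists_between hs
  set B : ℂ → ℝ := fun a ↦ ‖Complex.Gamma a‖ * (2 * Real.exp (Real.pi * |a.im|) *
    ∑' k : ℕ, ((k : ℝ) + 1) ^ (-p)) with hB
  have hBcont : ContinuousAt B s := by
    have hΓ : ContinuousAt Complex.Gamma s := by
      refine (Complex.differentiableAt_Gamma s fun m h ↦ ?_).continuousAt
      rw [h] at hs
      simp at hs
      linarith [m.cast_nonneg (α := ℝ)]
    exact hΓ.norm.mul (by fun_prop)
  refine ⟨B s + 1, ?_⟩
  filter_upwards [hBcont.eventually (eventually_le_nhds (lt_add_one (B s))),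
    (Complex.continuous_re.isOpen_preimage _ isOpen_Ioi).mem_nhds hps] with a haB hap v hv
  have hap' : p < a.re := hap
  refine ((norm_expPowerSumReg_le (hp1.trans hap') hv).trans ?_).trans haB
  have hsum : ∑' k : ℕ, ((k : ℝ) + 1) ^ (-a.re) ≤ ∑' k : ℕ, ((k : ℝ) + 1) ^ (-p) :=
    (summable_add_one_rpow (neg_lt_neg (hp1.trans hap'))).tsum_le_tsum
      (fun k ↦ Real.rpow_le_rpow_of_exponent_le (by simp) (neg_le_neg hap'.le))
      (summable_add_one_rpow (neg_lt_neg hp1))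
  exact mul_le_mul_of_nonneg_left (mul_le_mul_of_nonneg_left hsum (by positivity))
    (norm_nonneg _)

lemma ne_zero_of_re_pos {a : ℂ} (ha : 0 < a.re) : a ≠ 0 := by
  rintro rfl
  simp at ha

lemma tendsto_expPowerSumReg_of_re_pos {a : ℂ} (ha : 0 < a.re) :
    Tendsto (expPowerSumReg a) (𝓝[>] 0) (𝓝 (riemannZeta (1 - a))) := by
  have hopen : IsOpen {s : ℂ | 0 < s.re} := Complex.continuous_re.isOpen_preimage _ isOpen_Ioi
  have hderiv {s : ℂ} (hs : 0 < s.re) : ∀ v ∈ Set.Ioo (0 : ℝ) 1,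
      HasDerivAt (expPowerSumReg s) (-expPowerSumReg (s + 1) v) v :=
    fun v hv ↦ hasDerivAt_expPowerSumReg (ne_zero_of_re_pos hs) hv.1
  have hbound {s : ℂ} (hs : 0 < s.re) :
      ∃ C, ∀ᶠ z in 𝓝 s, ∀ v ∈ Set.Ioo (0 : ℝ) 1, ‖-expPowerSumReg (z + 1) v‖ ≤ C := by
    obtain ⟨C, hC⟩ := exists_locally_uniform_bound (s := s + 1) (by simpa using hs)
    refine ⟨C, ?_⟩
    have hadd : Tendsto (fun z : ℂ ↦ z + 1) (𝓝 s) (𝓝 (s + 1)) :=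
      (continuous_add_const 1).tendsto s
    filter_upwards [hadd.eventually hC] with z hz v hv
    rw [norm_neg]
    exact hz v hv.1
  have hex (s : ℂ) : ∃ l, 0 < s.re → Tendsto (expPowerSumReg s) (𝓝[>] 0) (𝓝 l) := by
    by_cases hs : 0 < s.re
    · obtain ⟨C, hC⟩ := hbound hs
      obtain ⟨l, hl⟩ := exists_tendsto_of_deriv_bound one_pos (hderiv hs) hC.self_of_nhds
      exact ⟨l, fun _ ↦ hl⟩
    · exact ⟨0, fun h ↦ absurd h hs⟩
  choose L hL using hex
  have hunif : TendstoLocallyUniformlyOn (fun v a ↦ expPowerSumReg a v) L (𝓝[>] 0)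
      {s : ℂ | 0 < s.re} := by
    rw [Metric.tendstoLocallyUniformlyOn_iff]
    intro ε hε s hs
    obtain ⟨C, hC⟩ := hbound hs
    refine ⟨_, mem_nhdsWithin_of_mem_nhds (hC.and (hopen.mem_nhds hs)), ?_⟩
    have hsmall : Tendsto (fun v : ℝ ↦ C * v) (𝓝[>] 0) (𝓝 0) :=
      ((continuous_const_mul C).tendsto' 0 0 (mul_zero C)).mono_left nhdsWithin_le_nhds
    filter_upwards [hsmall.eventually_lt_const hε, Ioo_mem_nhdsGT one_pos] with v hv hv1 z hz
    rw [dist_comm, dist_eq_norm]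
    exact (norm_sub_limit_le_of_deriv_bound (hderiv hz.2) hz.1 (hL z hz.2) hv1).trans_lt hv
  have hLdiff : DifferentiableOn ℂ L {s : ℂ | 0 < s.re} := by
    refine hunif.differentiableOn ?_ hopen
    filter_upwards [self_mem_nhdsWithin] with v hv s hs
    refine (differentiableAt_expPowerSumReg hv fun m h ↦ ?_).differentiableWithinAt
    have hs' : 0 < s.re := hs
    rw [h] at hs'
    simp at hs'
    linarith [m.cast_nonneg (α := ℝ)]
  have hζdiff : DifferentiableOn ℂ (fun s ↦ riemannZeta (1 - s)) {s : ℂ | 0 < s.re} := by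
    intro s hs
    have h1 : 1 - s ≠ 1 := by simpa using ne_zero_of_re_pos hs
    exact ((differentiableAt_riemannZeta h1).comp s
      (differentiableAt_id.const_sub 1)).differentiableWithinAt
  have heq : Set.EqOn L (fun s ↦ riemannZeta (1 - s)) {s : ℂ | 0 < s.re} := by
    refine (hLdiff.analyticOnNhd hopen).eqOn_of_preconnected_of_eventuallyEq
      (hζdiff.analyticOnNhd hopen) (convex_halfSpace_re_gt 0).isPreconnected (z₀ := 2) (by simp) ?_
    filter_upwards [(Complex.continuous_re.isOpen_preimage _ isOpen_Ioi).mem_nhds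
      (show (2 : ℂ) ∈ Complex.re ⁻¹' Set.Ioi 1 by simp)] with s hs
    have hs' : 1 < s.re := hs
    exact tendsto_nhds_unique (hL s (by linarith)) (tendsto_expPowerSumReg_of_one_lt_re hs')
  have : L a = riemannZeta (1 - a) := heq ha
  exact this ▸ hL a ha

lemma tendsto_expPowerSumReg_of_re_neg {a : ℂ} (ha : a.re < 0) :
    Tendsto (expPowerSumReg a) (𝓝[>] 0) (𝓝 (riemannZeta (1 - a))) := by
  have hpow : Tendsto (fun v : ℝ ↦ (v : ℂ) ^ (-a)) (𝓝[>] 0) (𝓝 0) := by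
    have h := Complex.continuousAt_ofReal_cpow_const 0 (-a) (.inl (by simpa using ha))
    have h0 : ((0 : ℝ) : ℂ) ^ (-a) = 0 := by
      rw [Complex.ofReal_zero, Complex.zero_cpow]
      intro h
      rw [neg_eq_zero] at h
      simp [h] at ha
    simpa only [ContinuousAt, h0] using h.tendsto.mono_left nhdsWithin_le_nhds
  have hζ : riemannZeta (1 - a) =
      ∑' k : ℕ, ((k : ℂ) + 1) ^ (a - 1) * Complex.exp (-(((k : ℂ) + 1) * (0 : ℝ))) := by
    rw [zeta_eq_tsum_one_div_nat_add_one_cpow (by simp; linarith)]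
    refine tsum_congr fun k ↦ ?_
    rw [one_div, ← Complex.cpow_neg]
    simp
  have hsum : Tendsto (expPowerSum a) (𝓝[>] 0) (𝓝 (riemannZeta (1 - a))) := by
    rw [hζ]
    refine tendsto_tsum_of_dominated_convergence (summable_add_one_rpow (p := a.re - 1)
      (by linarith)) (fun k ↦ ?_) ?_
    · have hcont : Continuous fun v : ℝ ↦
          ((k : ℂ) + 1) ^ (a - 1) * Complex.exp (-(((k : ℂ) + 1) * v)) := by fun_prop
      exact (hcont.tendsto 0).mono_left nhdsWithin_le_nhds
    · filter_upwards [self_mem_nhdsWithin] with v hv k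
      have hv' : 0 < v := hv
      rw [norm_expPowerSum_term]
      refine mul_le_of_le_one_right (by positivity) (Real.exp_le_one_iff.mpr ?_)
      have : 0 ≤ ((k : ℝ) + 1) * v := by positivity
      linarith
  have h := hsum.sub (hpow.const_mul (Complex.Gamma a))
  rwa [mul_zero, sub_zero] at h

lemma tendsto_expPowerSumReg_ofReal {x : ℝ} (hx : x ≠ 0) :
    Tendsto (expPowerSumReg x) (𝓝[>] 0) (𝓝 (riemannZeta (1 - x))) := by
  rcases hx.lt_or_gt with h | h
  · exact tendsto_expPowerSumReg_of_re_neg (by simpa using h)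
  · exact tendsto_expPowerSumReg_of_re_pos (by simpa using h)

lemma expPowerSumReg_ofReal (x : ℝ) {v : ℝ} (hv : 0 < v) :
    expPowerSumReg x v = ((∑' k : ℕ, ((k : ℝ) + 1) ^ (x - 1) * Real.exp (-(((k : ℝ) + 1) * v)) -
      Real.Gamma x * v ^ (-x) : ℝ) : ℂ) := by
  have hterm (k : ℕ) : ((k : ℂ) + 1) ^ ((x : ℂ) - 1) * Complex.exp (-(((k : ℂ) + 1) * v)) =
      ((((k : ℝ) + 1) ^ (x - 1) * Real.exp (-(((k : ℝ) + 1) * v)) : ℝ) : ℂ) := by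
    rw [Complex.ofReal_mul, Complex.ofReal_cpow (by positivity)]
    push_cast
    rfl
  rw [expPowerSumReg, expPowerSum, tsum_congr hterm, ← Complex.ofReal_tsum, Complex.Gamma_ofReal,
    ← Complex.ofReal_neg, ← Complex.ofReal_cpow hv.le]
  push_cast
  rfl

/-- Lemma 2.3, first part: for `δ ∉ {−1,−2,−3,…}`, as `v → 0⁺`,
`Σ_{k=1}^∞ k^δ e^{−kv} = Γ(δ+1) v^{−δ−1} + ζ(−δ) + O(v)`. -/
theorem polylog_asymp (δ : ℝ) (hδ : ∀ n : ℕ, δ ≠ -((n : ℝ) + 1)) :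
    ∃ C > (0 : ℝ), ∃ v₀ > (0 : ℝ), ∀ v : ℝ, 0 < v → v < v₀ →
      |(∑' k : ℕ, ((k : ℝ) + 1) ^ δ * Real.exp (-(((k : ℝ) + 1) * v)))
          - (Real.Gamma (δ + 1) * v ^ (-δ - 1) + (riemannZeta (-(δ : ℂ))).re)|
        ≤ C * v := by
  have h1 : δ + 1 ≠ 0 := fun h ↦ hδ 0 (by push_cast; linarith)
  have h2 : δ + 1 + 1 ≠ 0 := fun h ↦ hδ 1 (by push_cast; linarith)
  set C := ‖riemannZeta (1 - ((δ + 1 + 1 : ℝ) : ℂ))‖ + 1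
  have hev : ∀ᶠ v in 𝓝[>] (0 : ℝ), ‖expPowerSumReg ((δ + 1 + 1 : ℝ) : ℂ) v‖ ≤ C :=
    (tendsto_expPowerSumReg_ofReal h2).norm.eventually (eventually_le_nhds (lt_add_one _))
  obtain ⟨v₀, hv₀, hbound⟩ := mem_nhdsGT_iff_exists_Ioo_subset.mp hev
  refine ⟨C, by positivity, v₀, hv₀, fun v hv hv' ↦ ?_⟩
  have h := norm_sub_limit_le_of_deriv_bound (f := expPowerSumReg ((δ + 1 : ℝ) : ℂ))
    (fun x hx ↦ hasDerivAt_expPowerSumReg (by exact_mod_cast h1) hx.1)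
    (fun x hx ↦ by
      rw [norm_neg, ← Complex.ofReal_one, ← Complex.ofReal_add]
      exact hbound hx) (tendsto_expPowerSumReg_ofReal h1) ⟨hv, hv'⟩
  refine le_trans ?_ ((Complex.abs_re_le_norm _).trans h)
  rw [expPowerSumReg_ofReal _ hv, Complex.sub_re, Complex.ofReal_re,
    show 1 - ((δ + 1 : ℝ) : ℂ) = -(δ : ℂ) by push_cast; ring, add_sub_cancel_right, neg_add',
    sub_add_eq_sub_sub]
end
end

section
/- Let j ∈ ℕ and δ ∈ ℝ \ {−1, −2, −3, …}. Then, as v → 0⁺, Σ_{k=1}^∞ (log k)^j k^δ e^{−k v} = v^{−δ−1} Σ_{i=0}^j binom(j,i) (−log v)^{j−i} Γ^{(i)}(δ+1) + O(1), where Γ^{(i)} denotes the i-th derivative of the Gamma function; i.e. the main term is v^{−δ−1} (∂/∂δ − log v)^j Γ(δ+1) expanded binomially. -/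
open Filter Topology

noncomputable section

theorem integral_cpow_mul_cexp_neg_mul_Ioi {a : ℂ} (ha : 0 < a.re) {r : ℂ} (hr : 0 < r.re) :
    ∫ t : ℝ in Set.Ioi 0, (t : ℂ) ^ (a - 1) * Complex.exp (-(r * t))
      = r ^ (-a) * Complex.Gamma a := by
  have hU : IsOpen {z : ℂ | 0 < z.re} := isOpen_lt continuous_const Complex.continuous_re
  have hmeas : ∀ b z : ℂ, MeasureTheory.AEStronglyMeasurable
      (fun t : ℝ => (t : ℂ) ^ b * Complex.exp (-(z * t)))
      (MeasureTheory.volume.restrict (Set.Ioi 0)) := fun b z => by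
    refine ContinuousOn.aestronglyMeasurable (fun t ht => ?_) measurableSet_Ioi
    refine ContinuousAt.continuousWithinAt (ContinuousAt.mul ?_ (by fun_prop))
    exact Complex.continuousAt_ofReal_cpow_const _ _ (Or.inr (ne_of_gt ht))
  have hint : ∀ {s b : ℝ}, -1 < s → 0 < b → MeasureTheory.IntegrableOn
      (fun t : ℝ => t ^ s * Real.exp (-(b * t))) (Set.Ioi 0) := fun hs hb => by
    simpa using integrableOn_rpow_mul_exp_neg_mul_rpow hs one_pos hb
  have hnorm : ∀ (b z : ℂ) {t : ℝ}, 0 < t →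
      ‖(t : ℂ) ^ b * Complex.exp (-(z * t))‖ = t ^ b.re * Real.exp (-(z.re * t)) := by
    intro b z t ht
    rw [norm_mul, Complex.norm_cpow_eq_rpow_re_of_pos ht, Complex.norm_exp]
    simp
  have hL : DifferentiableOn ℂ (fun z : ℂ => ∫ t : ℝ in Set.Ioi 0,
      (t : ℂ) ^ (a - 1) * Complex.exp (-(z * t))) {z : ℂ | 0 < z.re} := by
    intro z hz
    have hz : 0 < z.re := hz
    have hV : {w : ℂ | z.re / 2 < w.re} ∈ 𝓝 z :=
      (isOpen_lt continuous_const Complex.continuous_re).mem_nhds (by simpa using hz)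
    refine DifferentiableAt.differentiableWithinAt (HasDerivAt.differentiableAt
      (hasDerivAt_integral_of_dominated_loc_of_deriv_le
        (bound := fun t : ℝ => t ^ a.re * Real.exp (-(z.re / 2 * t)))
        (F' := fun (w : ℂ) (t : ℝ) => -((t : ℂ) ^ a * Complex.exp (-(w * t)))) hV
        (.of_forall fun w => hmeas _ w) ?_ (hmeas _ z).neg ?_
        (hint (by linarith) (by linarith)) ?_).2)
    · refine (hint (s := a.re - 1) (by linarith) hz).mono' (hmeas _ z) ?_
      filter_upwards [MeasureTheory.ae_restrict_mem measurableSet_Ioi] with t ht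
      rw [hnorm _ _ ht]
      simp
    · filter_upwards [MeasureTheory.ae_restrict_mem measurableSet_Ioi] with t ht w hw
      have ht : 0 < t := ht
      have hw : z.re / 2 < w.re := hw
      rw [norm_neg, hnorm _ _ ht]
      gcongr
    · filter_upwards [MeasureTheory.ae_restrict_mem measurableSet_Ioi] with t ht w _
      have ht : (t : ℂ) ≠ 0 := Complex.ofReal_ne_zero.2 (ne_of_gt ht)
      refine ((((hasDerivAt_id w).mul_const (t : ℂ)).neg.cexp).const_mul
        ((t : ℂ) ^ (a - 1))).congr_deriv ?_
      rw [Complex.cpow_sub _ _ ht, Complex.cpow_one]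
      simp
      field_simp
  have hR : DifferentiableOn ℂ (fun z : ℂ => z ^ (-a) * Complex.Gamma a) {z : ℂ | 0 < z.re} :=
    fun z hz => ((hasDerivAt_id z).cpow_const
      (Or.inl hz)).differentiableAt.differentiableWithinAt.mul_const _
  have hfreq : ∃ᶠ z : ℂ in 𝓝[≠] (1 : ℂ), ∫ t : ℝ in Set.Ioi 0,
      (t : ℂ) ^ (a - 1) * Complex.exp (-(z * t)) = z ^ (-a) * Complex.Gamma a := by
    have ht : Tendsto (fun x : ℝ => (x : ℂ)) (𝓝[>] (1 : ℝ)) (𝓝[≠] (1 : ℂ)) := by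
      refine tendsto_nhdsWithin_iff.2 ⟨?_, ?_⟩
      · exact (Complex.continuous_ofReal.tendsto' 1 1 (by simp)).mono_left nhdsWithin_le_nhds
      · filter_upwards [self_mem_nhdsWithin] with x hx
        simpa using ne_of_gt hx
    refine ht.frequently (Eventually.frequently ?_)
    filter_upwards [self_mem_nhdsWithin] with x hx
    have hx : 0 < x := one_pos.trans hx
    rw [Complex.integral_cpow_mul_exp_neg_mul_Ioi ha hx, one_div, Complex.inv_cpow,
      Complex.cpow_neg]
    rw [Complex.arg_ofReal_of_nonneg hx.le]
    exact Real.pi_pos.ne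
  exact AnalyticOnNhd.eqOn_of_preconnected_of_frequently_eq (hL.analyticOnNhd hU)
    (hR.analyticOnNhd hU) (convex_halfSpace_re_gt 0).isPreconnected (by simp) hfreq hr

theorem summable_log_pow_mul_rpow_mul_exp (j : ℕ) (σ : ℝ) {v : ℝ} (hv : 0 < v) :
    Summable fun k : ℕ => Real.log ((k : ℝ) + 1) ^ j * ((k : ℝ) + 1) ^ σ
      * Real.exp (-(((k : ℝ) + 1) * v)) := by
  have hO : (fun x : ℝ => Real.log x ^ j * x ^ σ * Real.exp (-(x * v)))
      =O[atTop] fun x : ℝ => x ^ (-2 : ℝ) := by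
    have h1 := (isLittleO_log_rpow_rpow_atTop (j : ℝ) one_pos).isBigO
    have h2 := (isLittleO_exp_neg_mul_rpow_atTop hv (-3 - σ)).isBigO
    have h3 := (h1.mul (Asymptotics.isBigO_refl (fun x : ℝ => x ^ σ) atTop)).mul h2
    refine h3.congr' ?_ ?_
    · filter_upwards with x
      simp [mul_comm]
    · filter_upwards [eventually_gt_atTop 0] with x hx
      rw [← Real.rpow_add hx, ← Real.rpow_add hx]
      ring_nf
  have hs : Summable fun n : ℕ => Real.log (n : ℝ) ^ j * (n : ℝ) ^ σ
      * Real.exp (-((n : ℝ) * v)) :=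
    summable_of_isBigO_nat (Real.summable_nat_rpow.2 (by norm_num : (-2 : ℝ) < -1))
      (hO.comp_tendsto tendsto_natCast_atTop_atTop)
  simpa using (summable_nat_add_iff 1).2 hs

theorem summable_log_pow_mul_rpow (j : ℕ) {σ : ℝ} (hσ : σ < -1) :
    Summable fun k : ℕ => Real.log ((k : ℝ) + 1) ^ j * ((k : ℝ) + 1) ^ σ := by
  have hO : (fun x : ℝ => Real.log x ^ j * x ^ σ)
      =O[atTop] fun x : ℝ => x ^ ((σ - 1) / 2) := by
    have h1 := (isLittleO_log_rpow_rpow_atTop (j : ℝ)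
      (by linarith : 0 < (-1 - σ) / 2)).isBigO
    have h3 := h1.mul (Asymptotics.isBigO_refl (fun x : ℝ => x ^ σ) atTop)
    refine h3.congr' ?_ ?_
    · filter_upwards with x
      simp
    · filter_upwards [eventually_gt_atTop 0] with x hx
      rw [← Real.rpow_add hx]
      ring_nf
  have hs : Summable fun n : ℕ => Real.log (n : ℝ) ^ j * (n : ℝ) ^ σ :=
    summable_of_isBigO_nat (Real.summable_nat_rpow.2 (by linarith : (σ - 1) / 2 < -1))
      (hO.comp_tendsto tendsto_natCast_atTop_atTop)
  simpa using (summable_nat_add_iff 1).2 hs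

theorem tendsto_rpow_mul_neg_log_pow {a : ℝ} (ha : 0 < a) (m : ℕ) :
    Tendsto (fun v : ℝ => v ^ a * (-Real.log v) ^ m) (𝓝[>] 0) (𝓝 0) := by
  have h := (isLittleO_abs_log_rpow_rpow_nhdsGT_zero (m : ℝ) (neg_neg_of_pos ha)).tendsto_div_nhds_zero
  rw [tendsto_zero_iff_abs_tendsto_zero]
  refine h.congr' ?_
  filter_upwards [self_mem_nhdsWithin] with v hv
  have hv : 0 < v := hv
  simp [abs_mul, Real.rpow_neg hv.le, abs_of_pos (Real.rpow_pos_of_pos hv a), mul_comm]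

/-- The `k`-th term of `∑ (log (k + 1)) ^ j (k + 1) ^ s e ^ (-(k + 1) v)`. -/
def dirichletExpTerm (j : ℕ) (s : ℂ) (v : ℝ) (k : ℕ) : ℂ :=
  (Real.log ((k : ℝ) + 1) : ℂ) ^ j * (((k : ℝ) + 1 : ℝ) : ℂ) ^ s
    * (Real.exp (-(((k : ℝ) + 1) * v)) : ℂ)

/-- The series `∑ (log k) ^ j k ^ s e ^ (-k v)` over `k ≥ 1`. -/
def dirichletExp (j : ℕ) (s : ℂ) (v : ℝ) : ℂ := ∑' k : ℕ, dirichletExpTerm j s v k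

theorem norm_dirichletExpTerm (j : ℕ) (s : ℂ) (v : ℝ) (k : ℕ) :
    ‖dirichletExpTerm j s v k‖ = Real.log ((k : ℝ) + 1) ^ j * ((k : ℝ) + 1) ^ s.re
      * Real.exp (-(((k : ℝ) + 1) * v)) := by
  have hk : (0 : ℝ) < (k : ℝ) + 1 := by positivity
  have hl : 0 ≤ Real.log ((k : ℝ) + 1) := Real.log_nonneg (by simp)
  rw [dirichletExpTerm, norm_mul, norm_mul, norm_pow, Complex.norm_cpow_eq_rpow_re_of_pos hk,
    Complex.norm_real, Complex.norm_real, Real.norm_of_nonneg hl,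
    Real.norm_of_nonneg (Real.exp_pos _).le]

theorem summable_dirichletExpTerm (j : ℕ) (s : ℂ) {v : ℝ} (hv : 0 < v) :
    Summable (dirichletExpTerm j s v) :=
  .of_norm <| by
    simpa only [norm_dirichletExpTerm] using summable_log_pow_mul_rpow_mul_exp j s.re hv

theorem dirichletExp_ofReal (j : ℕ) (δ v : ℝ) :
    dirichletExp j δ v = ((∑' k : ℕ, Real.log ((k : ℝ) + 1) ^ j * ((k : ℝ) + 1) ^ δ
      * Real.exp (-(((k : ℝ) + 1) * v)) : ℝ) : ℂ) := by
  rw [dirichletExp, Complex.ofReal_tsum]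
  congr 1 with k
  rw [dirichletExpTerm, ← Complex.ofReal_cpow (by positivity)]
  push_cast
  rfl

theorem hasDerivAt_dirichletExp (j : ℕ) (s : ℂ) {v : ℝ} (hv : 0 < v) :
    HasDerivAt (fun z => dirichletExp j z v) (dirichletExp (j + 1) s v) s := by
  have ho : IsOpen {z : ℂ | z.re < s.re + 1} := isOpen_lt Complex.continuous_re continuous_const
  have hmem : s ∈ {z : ℂ | z.re < s.re + 1} := by simp
  refine hasDerivAt_tsum_of_isPreconnected (g := fun k z => dirichletExpTerm j z v k)
    (g' := fun k z => dirichletExpTerm (j + 1) z v k)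
    (summable_log_pow_mul_rpow_mul_exp (j + 1) (s.re + 1) hv) ho
    (convex_halfSpace_re_lt _).isPreconnected (fun k z _ => ?_) (fun k z hz => ?_) hmem
    (summable_dirichletExpTerm j s hv) hmem
  · have hk' : (0 : ℝ) < (k : ℝ) + 1 := by positivity
    have hk : (((k : ℝ) + 1 : ℝ) : ℂ) ≠ 0 := by
      exact_mod_cast (by positivity : (k : ℝ) + 1 ≠ 0)
    have h := (((hasDerivAt_id z).const_cpow (Or.inl hk)).const_mul
      ((Real.log ((k : ℝ) + 1) : ℂ) ^ j)).mul_const (Real.exp (-(((k : ℝ) + 1) * v)) : ℂ)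
    refine h.congr_deriv ?_
    simp only [dirichletExpTerm, Complex.ofReal_log hk'.le, id]
    ring
  · rw [norm_dirichletExpTerm]
    have hl : 0 ≤ Real.log ((k : ℝ) + 1) := Real.log_nonneg (by simp)
    gcongr
    · simp
    · exact le_of_lt hz

theorem iteratedDeriv_dirichletExp (j : ℕ) {v : ℝ} (hv : 0 < v) :
    iteratedDeriv j (fun z => dirichletExp 0 z v) = fun z => dirichletExp j z v := by
  induction j with
  | zero => simp
  | succ j ih =>
    rw [iteratedDeriv_succ, ih]
    exact funext fun z => (hasDerivAt_dirichletExp j z hv).deriv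

theorem hasDerivAt_dirichletExp_right (s : ℂ) {v : ℝ} (hv : 0 < v) :
    HasDerivAt (fun x => dirichletExp 0 s x) (-dirichletExp 0 (s + 1) v) v := by
  have hmem : v ∈ Set.Ioi (v / 2) := by simp [hv]
  rw [dirichletExp, ← tsum_neg]
  refine hasDerivAt_tsum_of_isPreconnected (g := fun k x => dirichletExpTerm 0 s x k)
    (g' := fun k x => -dirichletExpTerm 0 (s + 1) x k)
    (summable_log_pow_mul_rpow_mul_exp 0 (s.re + 1) (half_pos hv)) isOpen_Ioi
    isPreconnected_Ioi (fun k x _ => ?_) (fun k x hx => ?_) hmem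
    (summable_dirichletExpTerm 0 s hv) hmem
  · have hk : (((k : ℝ) + 1 : ℝ) : ℂ) ≠ 0 := by
      exact_mod_cast (by positivity : (k : ℝ) + 1 ≠ 0)
    have h := ((((hasDerivAt_id x).const_mul ((k : ℝ) + 1)).neg.exp).ofReal_comp).const_mul
      ((((k : ℝ) + 1 : ℝ) : ℂ) ^ s)
    have hf : (fun y => dirichletExpTerm 0 s y k) = fun y => (((k : ℝ) + 1 : ℝ) : ℂ) ^ s
        * ((Real.exp (-(((k : ℝ) + 1) * y)) : ℝ) : ℂ) := by
      ext y; simp [dirichletExpTerm]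
    rw [hf]
    refine h.congr_deriv ?_
    simp only [dirichletExpTerm, Complex.cpow_add _ _ hk]
    simp
    ring
  · rw [norm_neg, norm_dirichletExpTerm]
    simp only [Complex.add_re, Complex.one_re]
    gcongr
    exact le_of_lt hx

/-- The function `x ^ s e ^ (-v x)` on the positive half-line, extended by zero. -/
def cpowExp (s : ℂ) (v x : ℝ) : ℂ := ((max x 0 : ℝ) : ℂ) ^ s * Complex.exp (-(v * x))

theorem cpowExp_of_nonpos {s : ℂ} (hs : 0 < s.re) (v : ℝ) {x : ℝ} (hx : x ≤ 0) :
    cpowExp s v x = 0 := by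
  have : s ≠ 0 := by rintro rfl; simp at hs
  simp [cpowExp, max_eq_right hx, Complex.zero_cpow this]

theorem continuous_cpowExp {s : ℂ} (hs : 0 < s.re) (v : ℝ) : Continuous (cpowExp s v) :=
  ((Complex.continuous_ofReal_cpow_const hs).comp (continuous_id.max continuous_const)).mul
    (by fun_prop)

theorem cpowExp_isBigO {s : ℂ} (hs : 0 < s.re) {v : ℝ} (hv : 0 < v) :
    cpowExp s v =O[cocompact ℝ] fun x => |x| ^ (-2 : ℝ) := by
  rw [cocompact_eq_atBot_atTop, Asymptotics.isBigO_sup]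
  constructor
  · refine (Asymptotics.isBigO_zero _ _).congr' ?_ .rfl
    filter_upwards [eventually_le_atBot 0] with x hx
    exact (cpowExp_of_nonpos hs v hx).symm
  · have h := (Asymptotics.isBigO_refl (fun x : ℝ => x ^ s.re) atTop).mul
      (isLittleO_exp_neg_mul_rpow_atTop hv (-2 - s.re)).isBigO
    refine .of_norm_left (h.congr' ?_ ?_)
    · filter_upwards [eventually_gt_atTop 0] with x hx
      rw [cpowExp, max_eq_left hx.le, norm_mul, Complex.norm_cpow_eq_rpow_re_of_pos hx,
        Complex.norm_exp]
      simp
    · filter_upwards [eventually_gt_atTop 0] with x hx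
      rw [← Real.rpow_add hx, abs_of_pos hx]
      ring_nf

open FourierTransform in
theorem fourier_cpowExp {s : ℂ} (hs : 0 < s.re) {v : ℝ} (hv : 0 < v) (y : ℝ) :
    𝓕 (cpowExp s v) y
      = (v + 2 * Real.pi * y * Complex.I) ^ (-(s + 1)) * Complex.Gamma (s + 1) := by
  rw [Real.fourier_real_eq_integral_exp_smul, ← integral_cpow_mul_cexp_neg_mul_Ioi
    (by simp; linarith) (by simpa using hv),
    ← MeasureTheory.setIntegral_eq_integral_of_forall_compl_eq_zero (s := Set.Ioi 0)]
  · refine MeasureTheory.setIntegral_congr_fun measurableSet_Ioi fun x hx => ?_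
    have hx : 0 < x := hx
    simp only [cpowExp, max_eq_left hx.le, smul_eq_mul, add_sub_cancel_right]
    rw [mul_left_comm, ← Complex.exp_add]
    push_cast
    ring_nf
  · intro x hx
    rw [cpowExp_of_nonpos hs v (by simpa using hx), smul_zero]

theorem norm_cpow_lattice_le {s : ℂ} {σ M : ℝ} (hσ : 0 < σ) (hs : σ ≤ s.re) (hM : |s.im| ≤ M)
    (v : ℝ) {n : ℤ} (hn : n ≠ 0) :
    ‖((v : ℂ) + 2 * Real.pi * (n : ℝ) * Complex.I) ^ (-(s + 1))‖
      ≤ |(n : ℝ)| ^ (-(σ + 1)) * Real.exp (Real.pi * M) := by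
  set w : ℂ := (v : ℂ) + 2 * Real.pi * (n : ℝ) * Complex.I with hw
  have hn1 : (1 : ℝ) ≤ |(n : ℝ)| := by exact_mod_cast Int.one_le_abs hn
  have hnw : |(n : ℝ)| ≤ ‖w‖ := by
    have h := Complex.abs_im_le_norm w
    have him : w.im = 2 * Real.pi * n := by simp [hw]
    rw [him, abs_mul, abs_of_pos Real.two_pi_pos] at h
    nlinarith [Real.two_le_pi]
  have hw0 : w ≠ 0 := norm_pos_iff.1 (by linarith)
  rw [Complex.norm_cpow_of_ne_zero hw0, div_eq_mul_inv, ← Real.exp_neg]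
  have him : (-(s + 1)).im = -s.im := by simp
  have hre : (-(s + 1)).re = -(s.re + 1) := by simp
  rw [him, hre]
  gcongr ?_ * Real.exp ?_
  · calc ‖w‖ ^ (-(s.re + 1)) ≤ |(n : ℝ)| ^ (-(s.re + 1)) :=
          Real.rpow_le_rpow_of_nonpos (by linarith) hnw (by linarith)
      _ ≤ _ := Real.rpow_le_rpow_of_exponent_le hn1 (by linarith)
  · calc -(w.arg * -s.im) ≤ |w.arg * s.im| := by rw [mul_neg, neg_neg]; exact le_abs_self _
      _ = |w.arg| * |s.im| := abs_mul _ _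
      _ ≤ Real.pi * M := by gcongr; exact Complex.abs_arg_le_pi w

theorem summable_lattice {s : ℂ} (hs : 0 < s.re) (v : ℝ) :
    Summable fun n : ℤ => ((v : ℂ) + 2 * Real.pi * (n : ℝ) * Complex.I) ^ (-(s + 1))
      * Complex.Gamma (s + 1) := by
  refine Summable.mul_right _ (Summable.of_norm_bounded_eventually
    ((Real.summable_abs_int_rpow (by linarith : 1 < s.re + 1)).mul_right
      (Real.exp (Real.pi * |s.im|))) ?_)
  filter_upwards [(Set.finite_singleton (0 : ℤ)).compl_mem_cofinite] with n hn
  exact norm_cpow_lattice_le hs le_rfl le_rfl v hn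

/-- Lipschitz's summation formula. -/
theorem dirichletExp_zero_eq_tsum {s : ℂ} (hs : 0 < s.re) {v : ℝ} (hv : 0 < v) :
    dirichletExp 0 s v = ∑' n : ℤ, ((v : ℂ) + 2 * Real.pi * (n : ℝ) * Complex.I) ^ (-(s + 1))
      * Complex.Gamma (s + 1) := by
  have h := Real.tsum_eq_tsum_fourier_of_rpow_decay_of_summable (continuous_cpowExp hs v)
    one_lt_two (cpowExp_isBigO hs hv)
    ((summable_lattice hs v).congr fun n => (fourier_cpowExp hs hv n).symm) 0
  simp only [fourier_cpowExp hs hv, zero_add, QuotientAddGroup.mk_zero, fourier_eval_zero,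
    mul_one] at h
  rw [← h, dirichletExp]
  have hinj : Function.Injective fun k : ℕ => (k : ℤ) + 1 := fun a b hab => by
    simpa using hab
  rw [← hinj.tsum_eq (f := fun n : ℤ => cpowExp s v n)]
  · congr 1 with k
    have hk : (0 : ℝ) ≤ (k : ℝ) + 1 := by positivity
    simp only [dirichletExpTerm, cpowExp]
    push_cast
    rw [max_eq_left hk]
    push_cast
    ring_nf
  · intro n hn
    by_contra hne
    refine hn (cpowExp_of_nonpos hs v ?_)
    have : n ≤ 0 := by
      by_contra hlt
      exact hne ⟨(n - 1).toNat, by simp; omega⟩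
    exact_mod_cast this

/-- The difference between the series and its main term. -/
def dirichletExpError (s : ℂ) (v : ℝ) : ℂ :=
  dirichletExp 0 s v - (v : ℂ) ^ (-(s + 1)) * Complex.Gamma (s + 1)

theorem norm_dirichletExpError_le {s : ℂ} {σ M : ℝ} (hσ : 0 < σ) (hs : σ ≤ s.re)
    (hM : |s.im| ≤ M) {v : ℝ} (hv : 0 < v) :
    ‖dirichletExpError s v‖ ≤ (∑' n : ℤ, |(n : ℝ)| ^ (-(σ + 1))) * Real.exp (Real.pi * M)
      * ‖Complex.Gamma (s + 1)‖ := by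
  have h := (summable_lattice (hσ.trans_le hs) v).tsum_eq_add_tsum_ite 0
  have hsum := ((Real.summable_abs_int_rpow (by linarith : 1 < σ + 1)).hasSum.mul_right
    (Real.exp (Real.pi * M))).mul_right ‖Complex.Gamma (s + 1)‖
  rw [dirichletExpError, dirichletExp_zero_eq_tsum (hσ.trans_le hs) hv, h]
  simp only [Int.cast_zero, Complex.ofReal_zero, mul_zero, zero_mul, add_zero,
    add_sub_cancel_left]
  refine tsum_of_norm_bounded hsum fun n => ?_
  split_ifs with hn
  · rw [norm_zero]
    positivity
  · rw [norm_mul]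
    gcongr
    exact norm_cpow_lattice_le hσ hs hM v hn

theorem Gamma_differentiableAt_of_re_pos {s : ℂ} (hs : 0 < s.re) :
    DifferentiableAt ℂ Complex.Gamma s :=
  Complex.differentiableAt_Gamma s fun m h => by
    rw [h] at hs
    simp at hs
    linarith [(Nat.cast_nonneg m : (0 : ℝ) ≤ m)]

theorem sub_le_re_of_mem_closedBall {a r : ℝ} {s : ℂ} (hs : s ∈ Metric.closedBall (a : ℂ) r) :
    a - r ≤ s.re := by
  have h := (Complex.abs_re_le_norm (s - a)).trans (mem_closedBall_iff_norm.1 hs)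
  have h' := (abs_le.1 h).1
  simp at h'
  linarith

theorem abs_im_le_of_mem_closedBall {a r : ℝ} {s : ℂ}
    (hs : s ∈ Metric.closedBall (a : ℂ) r) : |s.im| ≤ r := by
  simpa using (Complex.abs_im_le_norm (s - a)).trans (mem_closedBall_iff_norm.1 hs)

theorem differentiableAt_dirichletExpError {s : ℂ} (hs : -1 < s.re) {v : ℝ} (hv : 0 < v) :
    DifferentiableAt ℂ (fun z => dirichletExpError z v) s := by
  have hs' : 0 < (s + 1).re := by simp; linarith
  have hv' : (v : ℂ) ≠ 0 := Complex.ofReal_ne_zero.2 hv.ne'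
  refine (hasDerivAt_dirichletExp 0 s hv).differentiableAt.sub (.mul ?_ ?_)
  · exact DifferentiableAt.const_cpow (by fun_prop) (Or.inl hv')
  · exact (Gamma_differentiableAt_of_re_pos hs').comp s (by fun_prop)

theorem hasDerivAt_dirichletExpError_right {s : ℂ} (hs : -1 < s.re) {v : ℝ} (hv : 0 < v) :
    HasDerivAt (dirichletExpError s) (-dirichletExpError (s + 1) v) v := by
  have hs' : s + 1 ≠ 0 := fun h => by
    have := congrArg Complex.re h
    simp at this
    linarith
  have h1 : HasDerivAt (fun x : ℝ => (x : ℂ) ^ (-(s + 1)))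
      (-(s + 1) * (v : ℂ) ^ (-(s + 1) - 1)) v := by
    have h : HasDerivAt (fun z : ℂ => z ^ (-(s + 1)))
        (-(s + 1) * (v : ℂ) ^ (-(s + 1) - 1) * 1) v :=
      (hasDerivAt_id (v : ℂ)).cpow_const (Or.inl hv)
    simpa using h.comp_ofReal
  refine ((hasDerivAt_dirichletExp_right s hv).sub
    (h1.mul_const (Complex.Gamma (s + 1)))).congr_deriv ?_
  rw [dirichletExpError, Complex.Gamma_add_one _ hs',
    show -(s + 1) - 1 = -(s + 1 + 1) by ring]
  ring

theorem exists_norm_dirichletExpError_le_of_pos {a r : ℝ} (har : 0 < a - r) :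
    ∃ C : ℝ, ∀ s ∈ Metric.closedBall (a : ℂ) r, ∀ v : ℝ, 0 < v →
      ‖dirichletExpError s v‖ ≤ C := by
  have hc : ContinuousOn (fun s : ℂ => Complex.Gamma (s + 1)) (Metric.closedBall (a : ℂ) r) := by
    intro s hs
    have h := sub_le_re_of_mem_closedBall hs
    have hs' : 0 < (s + 1).re := by simp; linarith
    have hG := Gamma_differentiableAt_of_re_pos hs'
    exact (ContinuousAt.comp (f := fun s : ℂ => s + 1) hG.continuousAt
      (by fun_prop)).continuousWithinAt
  obtain ⟨G, hG⟩ := (isCompact_closedBall (a : ℂ) r).exists_bound_of_continuousOn hc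
  refine ⟨(∑' n : ℤ, |(n : ℝ)| ^ (-(a - r + 1))) * Real.exp (Real.pi * r) * G,
    fun s hs v hv => ?_⟩
  refine (norm_dirichletExpError_le har (sub_le_re_of_mem_closedBall hs)
    (abs_im_le_of_mem_closedBall hs) hv).trans ?_
  have : 0 ≤ ∑' n : ℤ, |(n : ℝ)| ^ (-(a - r + 1)) := tsum_nonneg fun n => by positivity
  gcongr
  exact hG s hs

theorem exists_norm_dirichletExpError_le {a r : ℝ} (har : -1 < a - r) :
    ∃ C : ℝ, ∀ s ∈ Metric.closedBall (a : ℂ) r, ∀ v : ℝ, 0 < v → v ≤ 1 →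
      ‖dirichletExpError s v‖ ≤ C := by
  obtain ⟨C₁, hC₁⟩ := exists_norm_dirichletExpError_le_of_pos
    (a := a + 1) (r := r) (by linarith)
  have hc : ContinuousOn (fun s : ℂ => dirichletExpError s 1) (Metric.closedBall (a : ℂ) r) :=
    fun s hs => (differentiableAt_dirichletExpError
      (har.trans_le (sub_le_re_of_mem_closedBall hs)) one_pos).continuousAt.continuousWithinAt
  obtain ⟨C₀, hC₀⟩ := (isCompact_closedBall (a : ℂ) r).exists_bound_of_continuousOn hc
  refine ⟨C₁ + C₀, fun s hs v hv hv1 => ?_⟩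
  have hs1 : s + 1 ∈ Metric.closedBall ((a + 1 : ℝ) : ℂ) r := by
    simpa [mem_closedBall_iff_norm] using hs
  have hmvt := Convex.norm_image_sub_le_of_norm_hasDerivWithin_le (s := Set.Ioc (0 : ℝ) 1)
    (fun x hx => (hasDerivAt_dirichletExpError_right
      (har.trans_le (sub_le_re_of_mem_closedBall hs)) hx.1).hasDerivWithinAt)
    (fun x hx => (norm_neg _).trans_le (hC₁ (s + 1) hs1 x hx.1)) (convex_Ioc 0 1)
    (Set.right_mem_Ioc.2 one_pos) ⟨hv, hv1⟩
  have hC₁0 : 0 ≤ C₁ := (norm_nonneg _).trans (hC₁ (s + 1) hs1 v hv)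
  have hdist : ‖v - 1‖ ≤ 1 := by rw [Real.norm_eq_abs, abs_le]; constructor <;> linarith
  calc ‖dirichletExpError s v‖
      ≤ ‖dirichletExpError s v - dirichletExpError s 1‖ + ‖dirichletExpError s 1‖ := by
        simpa using norm_add_le (dirichletExpError s v - dirichletExpError s 1)
          (dirichletExpError s 1)
    _ ≤ C₁ + C₀ := add_le_add (hmvt.trans (mul_le_of_le_one_right hC₁0 hdist)) (hC₀ s hs)

theorem iteratedDeriv_re_of_real {f : ℂ → ℂ} {U : Set ℂ} (hU : IsOpen U)
    (hf : DifferentiableOn ℂ f U) (n : ℕ) {x : ℝ} (hx : (x : ℂ) ∈ U) :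
    iteratedDeriv n (fun y : ℝ => (f y).re) x = (iteratedDeriv n f x).re := by
  induction n generalizing x with
  | zero => simp
  | succ n ih =>
    have hmem : ∀ᶠ y : ℝ in 𝓝 x, (y : ℂ) ∈ U :=
      Complex.continuous_ofReal.continuousAt.eventually (hU.mem_nhds hx)
    have heq : iteratedDeriv n (fun y : ℝ => (f y).re)
        =ᶠ[𝓝 x] fun y : ℝ => (iteratedDeriv n f y).re := hmem.mono fun y hy => ih hy
    have hd : DifferentiableAt ℂ (iteratedDeriv n f) x := by
      rw [iteratedDeriv_eq_iterate]
      exact ((hf.analyticAt (hU.mem_nhds hx)).iterated_deriv n).differentiableAt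
    rw [iteratedDeriv_succ, heq.deriv_eq, hd.hasDerivAt.real_of_complex.deriv, iteratedDeriv_succ]

theorem iteratedDeriv_realGamma (n : ℕ) {x : ℝ} (hx : 0 < x) :
    iteratedDeriv n Real.Gamma x = (iteratedDeriv n Complex.Gamma x).re := by
  have hU : IsOpen {z : ℂ | 0 < z.re} := isOpen_lt continuous_const Complex.continuous_re
  rw [← iteratedDeriv_re_of_real hU (fun z hz =>
    (Gamma_differentiableAt_of_re_pos hz).differentiableWithinAt) n (by simpa using hx)]
  simp [Complex.Gamma_ofReal]

theorem iteratedDeriv_cpow_neg_add_one (n : ℕ) {v : ℝ} (hv : 0 < v) :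
    iteratedDeriv n (fun s : ℂ => (v : ℂ) ^ (-(s + 1)))
      = fun s => (-Complex.log v) ^ n * (v : ℂ) ^ (-(s + 1)) := by
  have hv' : (v : ℂ) ≠ 0 := Complex.ofReal_ne_zero.2 hv.ne'
  induction n with
  | zero => simp
  | succ n ih =>
    rw [iteratedDeriv_succ, ih]
    funext s
    have h := ((((hasDerivAt_id s).add_const (1 : ℂ)).neg.const_cpow
      (Or.inl hv')).const_mul ((-Complex.log v) ^ n))
    refine h.deriv.trans ?_
    simp
    ring

theorem re_iteratedDeriv_dirichletExpError (j : ℕ) {δ : ℝ} (hδ : -1 < δ) {v : ℝ} (hv : 0 < v) :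
    (iteratedDeriv j (fun s => dirichletExpError s v) δ).re
      = (∑' k : ℕ, Real.log ((k : ℝ) + 1) ^ j * ((k : ℝ) + 1) ^ δ
            * Real.exp (-(((k : ℝ) + 1) * v)))
          - v ^ (-δ - 1) * ∑ i ∈ Finset.range (j + 1),
              (j.choose i : ℝ) * (-Real.log v) ^ (j - i)
                * iteratedDeriv i Real.Gamma (δ + 1) := by
  have hv' : (v : ℂ) ≠ 0 := Complex.ofReal_ne_zero.2 hv.ne'
  have hU : {s : ℂ | -1 < s.re} ∈ 𝓝 (δ : ℂ) :=
    (isOpen_lt continuous_const Complex.continuous_re).mem_nhds (by simpa using hδ)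
  have hD : ContDiffAt ℂ j (fun s => dirichletExp 0 s v) δ :=
    (Differentiable.contDiff fun s => (hasDerivAt_dirichletExp 0 s hv).differentiableAt).contDiffAt
  have hP : ContDiffAt ℂ j (fun s : ℂ => (v : ℂ) ^ (-(s + 1))) δ :=
    (Differentiable.contDiff fun s =>
      DifferentiableAt.const_cpow (by fun_prop) (Or.inl hv')).contDiffAt
  have hG : ContDiffAt ℂ j (fun s : ℂ => Complex.Gamma (s + 1)) δ := by
    refine (DifferentiableOn.analyticAt (fun s hs => ?_) hU).contDiffAt
    have hs' : 0 < (s + 1).re := by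
      have : -1 < s.re := hs
      simp; linarith
    exact ((Gamma_differentiableAt_of_re_pos hs').comp s
      (by fun_prop)).differentiableWithinAt
  have hlog : -Complex.log v = ((-Real.log v : ℝ) : ℂ) := by
    rw [Complex.ofReal_neg, Complex.ofReal_log hv.le]
  have hpow : (v : ℂ) ^ (-((δ : ℂ) + 1)) = ((v ^ (-δ - 1) : ℝ) : ℂ) := by
    rw [Complex.ofReal_cpow hv.le]
    push_cast
    ring_nf
  have hE : (fun s => dirichletExpError s v) = fun s =>
      dirichletExp 0 s v - Complex.Gamma (s + 1) * (v : ℂ) ^ (-(s + 1)) :=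
    funext fun s => by rw [dirichletExpError, mul_comm ((v : ℂ) ^ _)]
  rw [hE, iteratedDeriv_fun_sub hD (hG.mul hP), iteratedDeriv_dirichletExp j hv,
    iteratedDeriv_fun_mul hG hP]
  beta_reduce
  rw [dirichletExp_ofReal, Complex.sub_re, Complex.ofReal_re,
    Complex.re_sum, Finset.mul_sum]
  congr 1
  refine Finset.sum_congr rfl fun i _ => ?_
  rw [iteratedDeriv_comp_add_const, iteratedDeriv_cpow_neg_add_one _ hv]
  simp only
  rw [hlog, hpow, iteratedDeriv_realGamma i (by linarith : 0 < δ + 1), Complex.ofReal_add,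
    Complex.ofReal_one, ← Complex.ofReal_natCast, ← Complex.ofReal_pow, ← Complex.ofReal_mul,
    Complex.re_mul_ofReal, Complex.re_ofReal_mul]
  ring

theorem polylog_asymp_log_of_gt {δ : ℝ} (j : ℕ) (hδ : -1 < δ) :
    ∃ C : ℝ, ∀ v : ℝ, 0 < v → v < 1 →
      |(∑' k : ℕ, Real.log ((k : ℝ) + 1) ^ j * ((k : ℝ) + 1) ^ δ
            * Real.exp (-(((k : ℝ) + 1) * v)))
          - v ^ (-δ - 1) * ∑ i ∈ Finset.range (j + 1),
              (j.choose i : ℝ) * (-Real.log v) ^ (j - i)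
                * iteratedDeriv i Real.Gamma (δ + 1)|
        ≤ C := by
  have hr : 0 < (δ + 1) / 2 := by linarith
  have hδr : -1 < δ - (δ + 1) / 2 := by linarith
  obtain ⟨C, hC⟩ := exists_norm_dirichletExpError_le hδr
  refine ⟨j.factorial * C / ((δ + 1) / 2) ^ j, fun v hv hv1 => ?_⟩
  rw [← re_iteratedDeriv_dirichletExpError j hδ hv]
  refine (Complex.abs_re_le_norm _).trans
    (Complex.norm_iteratedDeriv_le_of_forall_mem_sphere_norm_le j hr
      (DifferentiableOn.diffContOnCl fun s hs => ?_) fun s hs =>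
        hC s (Metric.sphere_subset_closedBall hs) v hv hv1.le)
  rw [closure_ball _ hr.ne'] at hs
  exact (differentiableAt_dirichletExpError
    (hδr.trans_le (sub_le_re_of_mem_closedBall hs)) hv).differentiableWithinAt

theorem polylog_asymp_log_of_lt {δ : ℝ} (j : ℕ) (hδ : δ < -1) (c : ℕ → ℝ) :
    ∃ C : ℝ, ∃ v₀ > (0 : ℝ), ∀ v : ℝ, 0 < v → v < v₀ →
      |(∑' k : ℕ, Real.log ((k : ℝ) + 1) ^ j * ((k : ℝ) + 1) ^ δ
            * Real.exp (-(((k : ℝ) + 1) * v)))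
          - v ^ (-δ - 1) * ∑ i ∈ Finset.range (j + 1),
              (j.choose i : ℝ) * (-Real.log v) ^ (j - i) * c i|
        ≤ C := by
  have hlim : Tendsto (fun v : ℝ => v ^ (-δ - 1) * ∑ i ∈ Finset.range (j + 1),
      (j.choose i : ℝ) * (-Real.log v) ^ (j - i) * c i) (𝓝[>] 0) (𝓝 0) := by
    have h := tendsto_finsetSum (Finset.range (j + 1)) fun i _ =>
      (tendsto_rpow_mul_neg_log_pow (by linarith : 0 < -δ - 1) (j - i)).const_mul
        ((j.choose i : ℝ) * c i)
    simp only [mul_zero, Finset.sum_const_zero] at h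
    refine h.congr fun v => ?_
    rw [Finset.mul_sum]
    exact Finset.sum_congr rfl fun i _ => by ring
  have hev := (tendsto_zero_iff_abs_tendsto_zero _).1 hlim |>.eventually (ge_mem_nhds one_pos)
  obtain ⟨v₀, hv₀, hmain⟩ := mem_nhdsGT_iff_exists_Ioo_subset.1 hev
  refine ⟨(∑' k : ℕ, Real.log ((k : ℝ) + 1) ^ j * ((k : ℝ) + 1) ^ δ) + 1, v₀, hv₀,
    fun v hv hvv₀ => (abs_sub _ _).trans (add_le_add ?_ (hmain ⟨hv, hvv₀⟩))⟩
  have hnn : ∀ k : ℕ, 0 ≤ Real.log ((k : ℝ) + 1) ^ j * ((k : ℝ) + 1) ^ δ := fun k =>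
    mul_nonneg (pow_nonneg (Real.log_nonneg (by simp)) _) (by positivity)
  rw [abs_of_nonneg (tsum_nonneg fun k => mul_nonneg (hnn k) (Real.exp_pos _).le)]
  refine (summable_log_pow_mul_rpow_mul_exp j δ hv).tsum_le_tsum (fun k => ?_)
    (summable_log_pow_mul_rpow j hδ)
  refine mul_le_of_le_one_right (hnn k) (Real.exp_le_one_iff.2 ?_)
  have : 0 ≤ ((k : ℝ) + 1) * v := by positivity
  linarith

/-- Lemma 2.3, second part: for `j ∈ ℕ` and `δ ∉ {−1,−2,−3,…}`,
as `v → 0⁺`,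
`Σ_{k=1}^∞ (log k)^j k^δ e^{−kv} = v^{−δ−1} (∂/∂δ − log v)^j Γ(δ+1) + O(1)`,
where the operator power is expanded binomially with `Γ^{(i)}` the `i`-th derivative
of the Gamma function. -/
theorem polylog_asymp_log (j : ℕ) (δ : ℝ) (hδ : ∀ n : ℕ, δ ≠ -((n : ℝ) + 1)) :
    ∃ C > (0 : ℝ), ∃ v₀ > (0 : ℝ), ∀ v : ℝ, 0 < v → v < v₀ →
      |(∑' k : ℕ, Real.log ((k : ℝ) + 1) ^ j * ((k : ℝ) + 1) ^ δ
            * Real.exp (-(((k : ℝ) + 1) * v)))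
          - v ^ (-δ - 1) * ∑ i ∈ Finset.range (j + 1),
              (j.choose i : ℝ) * (-Real.log v) ^ (j - i)
                * iteratedDeriv i Real.Gamma (δ + 1)|
        ≤ C := by
  rcases lt_or_gt_of_ne (show δ ≠ -1 by simpa using hδ 0) with h | h
  · obtain ⟨C, v₀, hv₀, hC⟩ := polylog_asymp_log_of_lt j h
      fun i => iteratedDeriv i Real.Gamma (δ + 1)
    exact ⟨max C 1, lt_max_of_lt_right one_pos, v₀, hv₀,
      fun v hv hvv₀ => (hC v hv hvv₀).trans (le_max_left _ _)⟩
  · obtain ⟨C, hC⟩ := polylog_asymp_log_of_gt j h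
    exact ⟨max C 1, lt_max_of_lt_right one_pos, 1, one_pos,
      fun v hv hv1 => (hC v hv hv1).trans (le_max_left _ _)⟩
end
end

section
/- Let (θ_m)_{m≥1} be non-negative weights and t > 0 with G_Θ(t) < ∞. Under the grand canonical measure ℙ_t, the cycle counts (C_k)_{k≥1} are mutually independent random variables, and each C_k is Poisson distributed with mean E_t[C_k] = θ_k t^k / k. -/
open Filter Topology MeasureTheory

noncomputable section

/-- `C_k(σ)`: the number of cycles of `σ` of length `k`
(fixed points count as cycles of length `1`). -/
def cycleCount {n : ℕ} (σ : Equiv.Perm (Fin n)) (k : ℕ) : ℕ :=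
  if k = 1 then (Finset.univ.filter fun a => σ a = a).card
  else Multiset.count k σ.cycleType

/-- `w_n(x)(σ) = Σ_{k ≥ x} C_k(σ)`, the number of cycles of length at least `x`. -/
def wshape {n : ℕ} (x : ℝ) (σ : Equiv.Perm (Fin n)) : ℕ :=
  ∑ k ∈ Finset.Icc 1 n, if x ≤ (k : ℝ) then cycleCount σ k else 0

/-- the weight `∏_{k=1}^n θ_k ^ C_k(σ)`. -/
def permWeight (θ : ℕ → ℝ) {n : ℕ} (σ : Equiv.Perm (Fin n)) : ℝ :=
  ∏ k ∈ Finset.Icc 1 n, θ k ^ cycleCount σ k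

open scoped Classical in
/-- the generalized Ewens measure `ℙ_n[A]`; the factors `1/(h_n n!)` cancel. -/
def Pn (θ : ℕ → ℝ) (n : ℕ) (A : Set (Equiv.Perm (Fin n))) : ℝ :=
  (∑ σ : Equiv.Perm (Fin n), if σ ∈ A then permWeight θ σ else 0) /
    ∑ σ : Equiv.Perm (Fin n), permWeight θ σ

/-- expectation `E_n[f]` with respect to the generalized Ewens measure. -/
def En (θ : ℕ → ℝ) (n : ℕ) (f : Equiv.Perm (Fin n) → ℝ) : ℝ :=
  (∑ σ : Equiv.Perm (Fin n), f σ * permWeight θ σ) /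
    ∑ σ : Equiv.Perm (Fin n), permWeight θ σ

/-- the upper incomplete Gamma function `Γ(a,x) = ∫_x^∞ s^{a-1} e^{-s} ds`. -/
def Γinc (a x : ℝ) : ℝ := ∫ s in Set.Ioi x, s ^ (a - 1) * Real.exp (-s)

/-- `n* = (1+α)^{-j} (n/(log n)^j)^{1/(α+1)}`. -/
def nstar (α : ℝ) (j : ℕ) (n : ℕ) : ℝ :=
  (1 + α) ^ (-(j : ℝ)) * ((n : ℝ) / Real.log n ^ j) ^ ((1 : ℝ) / (α + 1))

/-- `n̄ = n / n*`. -/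
def nbar (α : ℝ) (j : ℕ) (n : ℕ) : ℝ := (n : ℝ) / nstar α j n

/-- the CDF at `t` of a centered Gaussian with variance `v`. -/
def gaussCDF (v t : ℝ) : ℝ :=
  (Real.sqrt (2 * Real.pi * v))⁻¹ * ∫ u in Set.Iic t, Real.exp (-u ^ 2 / (2 * v))

/-- the weights `θ_m = (log m)^j m^α/Γ(α+1) + O(m^β)`. -/
def polyWeights (θ : ℕ → ℝ) (j : ℕ) (α β : ℝ) : Prop :=
  ∃ C : ℝ, ∀ m : ℕ, 1 ≤ m →
    |θ m - Real.log m ^ j * (m : ℝ) ^ α / Real.Gamma (α + 1)| ≤ C * (m : ℝ) ^ β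

/-- the grand canonical ensemble `⋃_n 𝔖_n`. -/
def GC : Type := Σ n : ℕ, Equiv.Perm (Fin n)

/-- `g_Θ(t) = Σ_{m≥1} (θ_m/m) t^m` (the `m = 0` summand is `0` by `θ_0/0 = 0`). -/
def gTheta (θ : ℕ → ℝ) (t : ℝ) : ℝ := ∑' m : ℕ, θ m / m * t ^ m

/-- the grand canonical weight `t^n/(G_Θ(t) n!) ∏_k θ_k^{C_k(σ)}` of `σ ∈ 𝔖_n`. -/
def gcWeight (θ : ℕ → ℝ) (t : ℝ) (p : GC) : ℝ :=
  t ^ p.1 / (Real.exp (gTheta θ t) * (Nat.factorial p.1 : ℝ)) * permWeight θ p.2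

open scoped Classical in
/-- the grand canonical measure `ℙ_t[A]`. -/
def Pt (θ : ℕ → ℝ) (t : ℝ) (A : Set GC) : ℝ :=
  ∑' p : GC, if p ∈ A then gcWeight θ t p else 0

/-- expectation `E_t[f]` with respect to `ℙ_t`. -/
def Et (θ : ℕ → ℝ) (t : ℝ) (f : GC → ℝ) : ℝ := ∑' p : GC, f p * gcWeight θ t p

/-- The multiset containing `F k` copies of each `k ∈ [2, N]`. -/
def cycleTypeOf (F : ℕ → ℕ) (N : ℕ) : Multiset ℕ :=
  ∑ k ∈ Finset.Icc 2 N, Multiset.replicate (F k) k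

lemma count_cycleTypeOf (F : ℕ → ℕ) (N j : ℕ) :
    (cycleTypeOf F N).count j = if j ∈ Finset.Icc 2 N then F j else 0 := by
  simp only [cycleTypeOf, Multiset.count_sum', Multiset.count_replicate, Finset.sum_ite_eq']

lemma mem_cycleTypeOf {F : ℕ → ℕ} {N j : ℕ} (h : j ∈ cycleTypeOf F N) :
    j ∈ Finset.Icc 2 N := by
  rw [← Multiset.count_pos, count_cycleTypeOf] at h
  by_contra hj
  simp [hj] at h

lemma sum_cycleTypeOf (F : ℕ → ℕ) (N : ℕ) :
    (cycleTypeOf F N).sum = ∑ k ∈ Finset.Icc 2 N, F k * k := by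
  simp [cycleTypeOf, Multiset.sum_sum]

lemma prod_cycleTypeOf (F : ℕ → ℕ) (N : ℕ) :
    (cycleTypeOf F N).prod = ∏ k ∈ Finset.Icc 2 N, k ^ F k := by
  simp [cycleTypeOf, Multiset.prod_sum]

lemma prod_factorial_count_cycleTypeOf (F : ℕ → ℕ) (N : ℕ) :
    ∏ k ∈ (cycleTypeOf F N).toFinset, ((cycleTypeOf F N).count k).factorial
      = ∏ k ∈ Finset.Icc 2 N, (F k).factorial := by
  rw [Finset.prod_subset (s₂ := Finset.Icc 2 N)
    (fun j hj => mem_cycleTypeOf (Multiset.mem_toFinset.1 hj))]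
  · refine Finset.prod_congr rfl fun k hk => ?_
    rw [count_cycleTypeOf, if_pos hk]
  · intro j _ hj
    rw [Multiset.count_eq_zero_of_notMem (by simpa using hj), Nat.factorial_zero]

lemma card_fixed_add_sum_cycleType {n : ℕ} (σ : Equiv.Perm (Fin n)) :
    cycleCount σ 1 + σ.cycleType.sum = n := by
  rw [Equiv.Perm.sum_cycleType, cycleCount, if_pos rfl]
  have := Finset.card_filter_add_card_filter_not (s := (Finset.univ : Finset (Fin n)))
    (fun a => σ a = a)
  rw [Finset.card_univ, Fintype.card_fin] at this
  convert this using 3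
  ext a
  simp

lemma cycleCount_eq_iff {n N : ℕ} {F : ℕ → ℕ} (hF : ∀ k, N < k → F k = 0)
    (σ : Equiv.Perm (Fin n)) :
    (∀ k, 1 ≤ k → cycleCount σ k = F k) ↔
      n = F 1 + (cycleTypeOf F N).sum ∧ σ.cycleType = cycleTypeOf F N := by
  have hn := card_fixed_add_sum_cycleType σ
  constructor
  · intro h
    have hσ : σ.cycleType = cycleTypeOf F N := by
      ext j
      rw [count_cycleTypeOf]
      by_cases hj : 2 ≤ j
      · have hc := h j (by omega)
        rw [cycleCount, if_neg (by omega)] at hc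
        rw [hc]
        split_ifs with hj'
        · rfl
        · exact hF j (by simp at hj'; omega)
      · rw [if_neg (by simp; omega), Multiset.count_eq_zero]
        exact fun hmem => hj (Equiv.Perm.two_le_of_mem_cycleType hmem)
    refine ⟨?_, hσ⟩
    rw [← hσ, ← h 1 le_rfl, hn]
  · rintro ⟨h1, h2⟩ k hk
    rcases hk.eq_or_lt with rfl | hk
    · rw [h2] at hn
      omega
    · rw [cycleCount, if_neg (by omega), h2, count_cycleTypeOf]
      split_ifs with hj
      · rfl
      · exact (hF k (by simp at hj; omega)).symm

lemma cycleCount_eq_zero {n k : ℕ} (σ : Equiv.Perm (Fin n)) (hk : n < k) :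
    cycleCount σ k = 0 := by
  unfold cycleCount
  split_ifs with h1
  · subst h1
    obtain rfl : n = 0 := by omega
    simp
  · rw [Multiset.count_eq_zero]
    intro hmem
    have := (Equiv.Perm.le_card_support_of_mem_cycleType hmem).trans (Finset.card_le_univ _)
    simp at this
    omega

lemma permWeight_eq_prod (θ : ℕ → ℝ) {n N : ℕ} {F : ℕ → ℕ} (hF : ∀ k, N < k → F k = 0)
    (σ : Equiv.Perm (Fin n)) (h : ∀ k, 1 ≤ k → cycleCount σ k = F k) :
    permWeight θ σ = ∏ k ∈ Finset.Icc 1 N, θ k ^ F k := by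
  have hprod : permWeight θ σ = ∏ k ∈ Finset.Icc 1 n, θ k ^ F k :=
    Finset.prod_congr rfl fun k hk => by rw [h k (Finset.mem_Icc.1 hk).1]
  rw [hprod, Finset.prod_subset (Finset.Icc_subset_Icc_right (le_max_left n N)),
    Finset.prod_subset (Finset.Icc_subset_Icc_right (le_max_right n N))]
  · intro k hk hk'
    simp only [Finset.mem_Icc] at hk hk'
    rw [hF k (by omega), pow_zero]
  · intro k hk hk'
    simp only [Finset.mem_Icc] at hk hk'
    rw [← h k hk.1, cycleCount_eq_zero σ (by omega), pow_zero]

open scoped Classical in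
/-- The total grand canonical weight of the permutations with prescribed cycle counts. -/
lemma tsum_gcWeight_of_cycleCount_eq {θ : ℕ → ℝ} (hθ : ∀ m, 0 ≤ θ m) {t : ℝ} (ht : 0 < t)
    {N : ℕ} (hN : 1 ≤ N) {F : ℕ → ℕ} (hF : ∀ k, N < k → F k = 0) :
    ∑' p : GC, (if ∀ k, 1 ≤ k → cycleCount p.2 k = F k then
        ENNReal.ofReal (gcWeight θ t p) else 0)
      = ENNReal.ofReal (Real.exp (-gTheta θ t)) *
        ∏ k ∈ Finset.Icc 1 N, ENNReal.ofReal ((θ k * t ^ k / k) ^ F k / (F k).factorial) := by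
  have hpos : ∀ k, 0 ≤ (θ k * t ^ k / k) ^ F k / ((F k).factorial : ℝ) := fun k => by
    have := hθ k
    positivity
  rw [← ENNReal.ofReal_prod_of_nonneg fun k _ => hpos k,
    ← ENNReal.ofReal_mul (Real.exp_pos _).le]
  set M := cycleTypeOf F N with hM
  set n := F 1 + M.sum with hn
  have hIcc : Finset.Icc 1 N = insert 1 (Finset.Icc 2 N) := by
    ext k; simp; omega
  have h1 : 1 ∉ Finset.Icc 2 N := by simp
  have hn' : n = ∑ k ∈ Finset.Icc 1 N, F k * k := by
    rw [hIcc, Finset.sum_insert h1, hn, hM, sum_cycleTypeOf, mul_one]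
  set c : ℝ := t ^ n / (Real.exp (gTheta θ t) * (n.factorial : ℝ)) *
    ∏ k ∈ Finset.Icc 1 N, θ k ^ F k with hc
  have hc0 : 0 ≤ c := by
    have : 0 ≤ ∏ k ∈ Finset.Icc 1 N, θ k ^ F k :=
      Finset.prod_nonneg fun k _ => pow_nonneg (hθ k) _
    positivity
  change ∑' p : (Σ n : ℕ, Equiv.Perm (Fin n)), _ = _
  rw [ENNReal.tsum_sigma', tsum_eq_single n]
  · have hterm : ∀ σ : Equiv.Perm (Fin n),
        (if ∀ k, 1 ≤ k → cycleCount σ k = F k then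
          ENNReal.ofReal (gcWeight θ t ⟨n, σ⟩) else 0)
        = if σ.cycleType = M then ENNReal.ofReal c else 0 := by
      intro σ
      by_cases h : ∀ k, 1 ≤ k → cycleCount σ k = F k
      · rw [if_pos h, if_pos ((cycleCount_eq_iff hF σ).1 h).2, hc,
          ← permWeight_eq_prod θ hF σ h]
        rfl
      · rw [if_neg h, if_neg fun h' => h ((cycleCount_eq_iff hF σ).2 ⟨rfl, h'⟩)]
    rw [tsum_fintype, Finset.sum_congr rfl fun σ _ => hterm σ, ← Finset.sum_filter,
      Finset.sum_const, nsmul_eq_mul, ← ENNReal.ofReal_natCast, ← ENNReal.ofReal_mul (by simp)]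
    congr 1
    have hcard := Equiv.Perm.card_of_cycleType_mul_eq (Fin n) M
    rw [Fintype.card_fin, if_pos ⟨by omega, fun a ha => (Finset.mem_Icc.1 (mem_cycleTypeOf ha)).1⟩,
      show n - M.sum = F 1 by omega, hM, prod_cycleTypeOf, prod_factorial_count_cycleTypeOf,
      ← hM] at hcard
    have hden : (F 1).factorial * (∏ k ∈ Finset.Icc 2 N, k ^ F k) *
        ∏ k ∈ Finset.Icc 2 N, (F k).factorial
        = (∏ k ∈ Finset.Icc 1 N, k ^ F k) * ∏ k ∈ Finset.Icc 1 N, (F k).factorial := by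
      rw [hIcc, Finset.prod_insert h1, Finset.prod_insert h1]
      ring
    rw [hden] at hcard
    have hcard' := congrArg (Nat.cast (R := ℝ)) hcard
    push_cast at hcard'
    have ht' : t ^ n = ∏ k ∈ Finset.Icc 1 N, (t ^ k) ^ F k := by
      rw [hn', ← Finset.prod_pow_eq_pow_sum]
      exact Finset.prod_congr rfl fun k _ => by rw [mul_comm, pow_mul]
    simp only [div_pow, mul_pow, Finset.prod_div_distrib, Finset.prod_mul_distrib]
    rw [← ht', hc, Real.exp_neg]
    have e1 : (∏ k ∈ Finset.Icc 1 N, (k : ℝ) ^ F k) ≠ 0 :=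
      Finset.prod_ne_zero_iff.2 fun k hk => by
        have := (Finset.mem_Icc.1 hk).1
        positivity
    have e2 : (∏ k ∈ Finset.Icc 1 N, ((F k).factorial : ℝ)) ≠ 0 :=
      Finset.prod_ne_zero_iff.2 fun k _ => by positivity
    have e3 : (n.factorial : ℝ) ≠ 0 := by positivity
    field_simp
    rw [← hcard']
    ring
  · intro n' hn'
    refine ENNReal.tsum_eq_zero.2 fun σ => if_neg fun h => ?_
    exact hn' ((cycleCount_eq_iff hF σ).1 h).1

lemma tsum_pi_prod_eq_prod_tsum {α : Type*} {N : ℕ} (h : Fin N → α → ENNReal) :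
    ∑' f : Fin N → α, ∏ i, h i (f i) = ∏ i, ∑' a, h i a := by
  induction N with
  | zero => simp
  | succ N ih =>
    rw [← (Fin.consEquiv fun _ => α).tsum_eq, ENNReal.tsum_prod', Fin.prod_univ_succ]
    simp only [Fin.consEquiv_apply, Fin.prod_univ_succ, Fin.cons_zero, Fin.cons_succ,
      ENNReal.tsum_mul_left, ih]
    rw [ENNReal.tsum_mul_right]

lemma tsum_ofReal_pow_div_factorial {x : ℝ} (hx : 0 ≤ x) :
    ∑' n : ℕ, ENNReal.ofReal (x ^ n / n.factorial) = ENNReal.ofReal (Real.exp x) := by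
  have h : HasSum (fun n : ℕ => x ^ n / (n.factorial : ℝ)) (Real.exp x) := by
    rw [Real.exp_eq_exp_ℝ]
    exact NormedSpace.expSeries_div_hasSum_exp x
  rw [← h.tsum_eq, ENNReal.ofReal_tsum_of_nonneg (fun n => by positivity) h.summable]

open scoped Classical in
/-- The weight of the permutations with prescribed numbers of cycles of length `k ∈ S` and
without cycles longer than `N`. -/
lemma tsum_gcWeight_of_cycle_length_le {θ : ℕ → ℝ} (hθ : ∀ m, 0 ≤ θ m) {t : ℝ} (ht : 0 < t)
    {N : ℕ} (hN : 1 ≤ N) {S : Finset ℕ} (hS : S ⊆ Finset.Icc 1 N) (m : ℕ → ℕ) :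
    ∑' p : GC, (if (∀ k ∈ S, cycleCount p.2 k = m k) ∧ ∀ k, N < k → cycleCount p.2 k = 0 then
        ENNReal.ofReal (gcWeight θ t p) else 0)
      = ENNReal.ofReal (Real.exp (-gTheta θ t) *
        ((∏ k ∈ S, (θ k * t ^ k / k) ^ m k / (m k).factorial) *
          ∏ k ∈ Finset.Icc 1 N \ S, Real.exp (θ k * t ^ k / k))) := by
  set a : ℕ → ℝ := fun k => θ k * t ^ k / k with ha
  have ha0 : ∀ k, 0 ≤ a k := fun k => by
    have := hθ k
    positivity
  set extend : (Fin N → ℕ) → ℕ → ℕ := fun f k =>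
    if hk : 1 ≤ k ∧ k ≤ N then f ⟨k - 1, by omega⟩ else 0 with hextend
  have hextend_succ : ∀ f (i : Fin N), extend f (i + 1) = f i := fun f i => by
    simp [hextend, i.2, Nat.succ_le_iff]
  have hextend_zero : ∀ f k, N < k → extend f k = 0 := fun f k hk => by
    simp only [hextend]
    rw [dif_neg (by omega)]
  set E : (Fin N → ℕ) → Prop := fun f => ∀ k ∈ S, extend f k = m k with hE
  have hIcc : ∀ φ : ℕ → ENNReal, ∏ k ∈ Finset.Icc 1 N, φ k = ∏ i : Fin N, φ (i + 1) := by
    intro φ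
    rw [Fin.prod_univ_eq_prod_range (fun i => φ (i + 1)), Finset.range_eq_Ico,
      Finset.prod_Ico_add' φ 0 N 1]
    rfl
  have hsplit : ∀ p : GC,
      (if (∀ k ∈ S, cycleCount p.2 k = m k) ∧ ∀ k, N < k → cycleCount p.2 k = 0 then
        ENNReal.ofReal (gcWeight θ t p) else 0)
      = ∑' f : Fin N → ℕ, if E f then (if ∀ k, 1 ≤ k → cycleCount p.2 k = extend f k then
        ENNReal.ofReal (gcWeight θ t p) else 0) else 0 := by
    intro p
    set f₀ : Fin N → ℕ := fun i => cycleCount p.2 (i + 1) with hf₀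
    have hextend_f₀ : ∀ k, 1 ≤ k → k ≤ N → extend f₀ k = cycleCount p.2 k := by
      intro k h1 h2
      simp only [hextend, hf₀]
      rw [dif_pos ⟨h1, h2⟩, Nat.sub_add_cancel h1]
    rw [tsum_eq_single f₀]
    · have hiff : ((∀ k ∈ S, cycleCount p.2 k = m k) ∧ ∀ k, N < k → cycleCount p.2 k = 0) ↔
          E f₀ ∧ ∀ k, 1 ≤ k → cycleCount p.2 k = extend f₀ k := by
        refine and_congr (forall₂_congr fun k hk => ?_) ⟨fun h k hk => ?_, fun h k hk => ?_⟩
        · have := Finset.mem_Icc.1 (hS hk)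
          rw [hextend_f₀ k this.1 this.2]
        · rcases le_or_gt k N with hkN | hkN
          · exact (hextend_f₀ k hk hkN).symm
          · rw [h k hkN, hextend_zero _ _ hkN]
        · rw [h k (by omega), hextend_zero _ _ hk]
      simp only [hiff, ite_and]
    · intro f hf
      split_ifs with h1 h2
      · exact absurd (funext fun i => by rw [← hextend_succ f i, ← h2 _ (by omega)]) hf
      · rfl
      · rfl
  rw [tsum_congr hsplit, ENNReal.tsum_comm]
  set h : ℕ → ℕ → ENNReal := fun k n =>
    if k ∈ S → n = m k then ENNReal.ofReal (a k ^ n / n.factorial) else 0 with hh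
  have hinner : ∀ f : Fin N → ℕ,
      (∑' p : GC, if E f then (if ∀ k, 1 ≤ k → cycleCount p.2 k = extend f k then
        ENNReal.ofReal (gcWeight θ t p) else 0) else 0)
      = ENNReal.ofReal (Real.exp (-gTheta θ t)) * ∏ i : Fin N, h (i + 1) (f i) := by
    intro f
    have hfac : ∏ i : Fin N, h (i + 1) (f i) = ∏ k ∈ Finset.Icc 1 N, h k (extend f k) := by
      rw [hIcc]
      simp only [hextend_succ]
    rw [hfac]
    by_cases hf : E f
    · simp only [if_pos hf]
      rw [tsum_gcWeight_of_cycleCount_eq hθ ht hN (hextend_zero f)]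
      congr 1
      refine Finset.prod_congr rfl fun k _ => ?_
      simp only [hh]
      rw [if_pos fun hk => hf k hk]
    · simp only [if_neg hf, tsum_zero]
      simp only [hE, not_forall] at hf
      obtain ⟨k, hk, hkm⟩ := hf
      rw [Finset.prod_eq_zero (hS hk), mul_zero]
      simp only [hh]
      rw [if_neg fun h' => hkm (h' hk)]
  have hsum : ∀ k, ∑' n, h k n = if k ∈ S then ENNReal.ofReal (a k ^ m k / (m k).factorial)
      else ENNReal.ofReal (Real.exp (a k)) := by
    intro k
    by_cases hk : k ∈ S
    · simp only [hh, hk, forall_const, if_true]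
      rw [tsum_ite_eq]
    · simp only [hh, hk, false_imp_iff, if_true, if_false]
      exact tsum_ofReal_pow_div_factorial (ha0 k)
  rw [tsum_congr hinner, ENNReal.tsum_mul_left,
    tsum_pi_prod_eq_prod_tsum fun (i : Fin N) n => h (i + 1) n]
  simp only [hsum]
  rw [← hIcc fun k => if k ∈ S then ENNReal.ofReal (a k ^ m k / (m k).factorial)
      else ENNReal.ofReal (Real.exp (a k)), ENNReal.ofReal_mul (Real.exp_pos _).le,
    ENNReal.ofReal_mul (Finset.prod_nonneg fun k _ => by have := ha0 k; positivity),
    ENNReal.ofReal_prod_of_nonneg fun k _ => by have := ha0 k; positivity,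
    ENNReal.ofReal_prod_of_nonneg fun k _ => (Real.exp_pos _).le,
    Finset.prod_ite, Finset.filter_mem_eq_inter, Finset.inter_eq_right.2 hS,
    Finset.filter_notMem_eq_sdiff]

/-- Lemma 3.1: under the grand canonical measure `ℙ_t`, the cycle counts
`(C_k)_{k ≥ 1}` are mutually independent and `C_k` is Poisson with mean `θ_k t^k / k`:
the joint distribution of any finite family factorizes into Poisson probabilities. -/
theorem grand_canonical_poisson (θ : ℕ → ℝ) (hθ0 : ∀ m, 0 ≤ θ m) (t : ℝ) (ht : 0 < t)
    (hfin : Summable fun m : ℕ => θ m / m * t ^ m) :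
    ∀ S : Finset ℕ, (∀ k ∈ S, 1 ≤ k) → ∀ m : ℕ → ℕ,
      Pt θ t {p : GC | ∀ k ∈ S, cycleCount p.2 k = m k}
        = ∏ k ∈ S,
            Real.exp (-(θ k * t ^ k / k)) * (θ k * t ^ k / k) ^ m k
              / (Nat.factorial (m k) : ℝ) := by
  classical
  intro S hS m
  set a : ℕ → ℝ := fun k => θ k * t ^ k / k with ha
  have ha' : ∀ k, θ k / k * t ^ k = a k := fun k => by simp only [ha]; ring
  have ha0 : ∀ k, 0 ≤ a k := fun k => by
    have := hθ0 k
    positivity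
  simp only [ha'] at hfin
  have hw : ∀ p, 0 ≤ gcWeight θ t p := fun p => by
    have : 0 ≤ permWeight θ p.2 := Finset.prod_nonneg fun k _ => pow_nonneg (hθ0 k) _
    unfold gcWeight
    positivity
  have hrhs : ∏ k ∈ S, Real.exp (-a k) * a k ^ m k / ((m k).factorial : ℝ)
      = Real.exp (-∑ k ∈ S, a k) * ∏ k ∈ S, a k ^ m k / ((m k).factorial : ℝ) := by
    rw [← Finset.sum_neg_distrib, Real.exp_sum, ← Finset.prod_mul_distrib]
    exact Finset.prod_congr rfl fun k _ => mul_div_assoc _ _ _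
  rw [hrhs]
  set Q : ℝ := ∏ k ∈ S, a k ^ m k / ((m k).factorial : ℝ) with hQ
  have hQ0 : 0 ≤ Q := Finset.prod_nonneg fun k _ => by have := ha0 k; positivity
  have hg : gTheta θ t = ∑' k, a k := tsum_congr ha'
  set P : ENNReal := ∑' p : GC, if ∀ k ∈ S, cycleCount p.2 k = m k then
    ENNReal.ofReal (gcWeight θ t p) else 0 with hP
  set U : ℕ → ENNReal := fun N => ∑' p : GC,
    if (∀ k ∈ S, cycleCount p.2 k = m k) ∧ ∀ k, N < k → cycleCount p.2 k = 0 then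
      ENNReal.ofReal (gcWeight θ t p) else 0 with hU
  obtain ⟨N₀, hN₀⟩ : ∃ N₀, 1 ≤ N₀ ∧ S ⊆ Finset.Icc 1 N₀ :=
    ⟨S.sup id + 1, by omega, fun k hk => Finset.mem_Icc.2
      ⟨hS k hk, (Finset.le_sup (f := id) hk).trans (Nat.le_succ _)⟩⟩
  have hUval : ∀ N, N₀ ≤ N → U N = ENNReal.ofReal
      (Real.exp (∑ k ∈ Finset.range (N + 1), a k - gTheta θ t - ∑ k ∈ S, a k) * Q) := by
    intro N hN
    have hSN := hN₀.2.trans (Finset.Icc_subset_Icc_right hN)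
    simp only [hU]
    rw [tsum_gcWeight_of_cycle_length_le hθ0 ht (hN₀.1.trans hN) hSN m, ← Real.exp_sum]
    have hsd := Finset.sum_sdiff (f := a) hSN
    have hrange : ∑ k ∈ Finset.range (N + 1), a k = ∑ k ∈ Finset.Icc 1 N, a k := by
      rw [Finset.sum_range_succ', Finset.range_eq_Ico, Finset.sum_Ico_add' a 0 N 1]
      simp only [ha, Nat.cast_zero, div_zero, add_zero]
      rfl
    rw [mul_left_comm, ← Real.exp_add, mul_comm]
    congr 3
    rw [hrange]
    linarith
  have hlim : Tendsto U atTop (𝓝 (ENNReal.ofReal (Real.exp (-∑ k ∈ S, a k) * Q))) := by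
    have h1 := (hfin.hasSum.tendsto_sum_nat.comp (tendsto_add_atTop_nat 1)).sub_const
      (gTheta θ t) |>.sub_const (∑ k ∈ S, a k)
    rw [hg, sub_self, zero_sub, ← hg] at h1
    refine (ENNReal.tendsto_ofReal
      (((Real.continuous_exp.tendsto _).comp h1).mul_const Q)).congr' ?_
    filter_upwards [eventually_ge_atTop N₀] with N hN
    exact (hUval N hN).symm
  have hUP : ∀ N, U N ≤ P := fun N => ENNReal.tsum_le_tsum fun p => by
    by_cases h1 : ∀ k ∈ S, cycleCount p.2 k = m k
    · rw [if_pos h1]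
      split_ifs <;> simp
    · rw [if_neg h1, if_neg fun h => h1 h.1]
  have hmono : Monotone U := fun N N' hNN' => ENNReal.tsum_le_tsum fun p => by
    split_ifs with h1 h2
    · rfl
    · exact absurd ⟨h1.1, fun k hk => h1.2 k (hNN'.trans_lt hk)⟩ h2
    · exact zero_le
    · rfl
  have hPlim : P = ENNReal.ofReal (Real.exp (-∑ k ∈ S, a k) * Q) := by
    refine le_antisymm ?_ (le_of_tendsto' hlim hUP)
    rw [hP, ENNReal.tsum_eq_iSup_sum]
    refine iSup_le fun s => ?_
    refine le_trans ?_ (hmono.ge_of_tendsto hlim (s.sup Sigma.fst))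
    refine le_trans (Finset.sum_le_sum fun p hp => ?_) (ENNReal.sum_le_tsum s)
    have hlong : ∀ k, s.sup Sigma.fst < k → cycleCount p.2 k = 0 := fun k hk =>
      cycleCount_eq_zero p.2 ((Finset.le_sup (f := Sigma.fst) hp).trans_lt hk)
    by_cases h1 : ∀ k ∈ S, cycleCount p.2 k = m k
    · rw [if_pos h1, if_pos ⟨h1, hlong⟩]
    · rw [if_neg h1]
      exact zero_le
  calc Pt θ t {p : GC | ∀ k ∈ S, cycleCount p.2 k = m k} = P.toReal := by
        rw [hP, ENNReal.tsum_toReal_eq fun p => by split_ifs <;> simp]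
        refine tsum_congr fun p => ?_
        simp only [Set.mem_ofPred_eq]
        split_ifs
        · rw [ENNReal.toReal_ofReal (hw p)]
        · rfl
    _ = Real.exp (-∑ k ∈ S, a k) * Q := by
        rw [hPlim, ENNReal.toReal_ofReal (by positivity)]
end
end

section
/- Let (g_n)_{n∈ℕ} be a log-n-admissible sequence of functions: g_n(t) = Σ_{k≥0} g_{k,n} t^k with g_{k,n} ≥ 0 and common radius of convergence ρ > 0; set a_n(r) := r g_n'(r) and b_n(r) := r g_n'(r) + r² g_n''(r); assume there exist r_n ∈ [0, ρ) with a_n(r_n) = n (saddle point), a sequence δ_n → 0 with b_n(r_n) → ∞ and δ_n² b_n(r_n) − log b_n(r_n) → +∞, such that for all |φ| ≤ δ_n one has g_n(r_n e^{iφ}) = g_n(r_n) + iφ a_n(r_n) − (φ²/2) b_n(r_n) + R_n(r_n, φ) with R_n(r_n, φ) = o(φ³ δ_n^{−3}) uniformly, and such that for all δ_n < |φ| ≤ π one has Re g_n(r_n e^{iφ}) ≤ Re g_n(r_n e^{i δ_n sign(φ)}) (monotonicity). Then the n-th Taylor coefficient G_n := [t^n] exp(g_n(t)) satisfies the asymptotic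 expansion G_n = (2π)^{−1/2} r_n^{−n} b_n(r_n)^{−1/2} exp(g_n(r_n)) (1 + o(1)) as n → ∞. -/
open Filter Topology

noncomputable section

/-- A power series with non-negative coefficients that converges on `(-ρ, ρ)` defines a
holomorphic function on the disk of radius `ρ`. -/
theorem differentiableOn_tsum_ofReal_mul_pow {c : ℕ → ℝ} (hc : ∀ k, 0 ≤ c k) {ρ : ℝ}
    (hsum : ∀ s : ℝ, |s| < ρ → Summable fun k => c k * s ^ k) :
    DifferentiableOn ℂ (fun z : ℂ => ∑' k, (c k : ℂ) * z ^ k) (Metric.ball 0 ρ) := by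
  intro z hz
  rw [mem_ball_zero_iff] at hz
  obtain ⟨s, hzs, hsρ⟩ := exists_between hz
  have hs : 0 ≤ s := (norm_nonneg z).trans hzs.le
  have hd : DifferentiableOn ℂ (fun z : ℂ => ∑' k, (c k : ℂ) * z ^ k) (Metric.ball 0 s) := by
    refine Complex.differentiableOn_tsum_of_summable_norm (hsum s (by rwa [abs_of_nonneg hs]))
      (fun k => by fun_prop) Metric.isOpen_ball fun k w hw => ?_
    rw [mem_ball_zero_iff] at hw
    rw [norm_mul, norm_pow, Complex.norm_real, Real.norm_of_nonneg (hc k)]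
    gcongr
    exact hc k
  exact (hd.differentiableAt (Metric.isOpen_ball.mem_nhds
    (mem_ball_zero_iff.mpr hzs))).differentiableWithinAt

/-- Iterated derivatives of the real part of a holomorphic function along the real axis. -/
theorem iteratedDeriv_eq_re_of_differentiableOn {f : ℝ → ℝ} {F : ℂ → ℂ} {ρ : ℝ}
    (hF : DifferentiableOn ℂ F (Metric.ball 0 ρ))
    (hf : ∀ x : ℝ, |x| < ρ → f x = (F x).re) (n : ℕ) :
    ∀ x : ℝ, |x| < ρ → iteratedDeriv n f x = (iteratedDeriv n F x).re := by
  induction n with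
  | zero => simpa using hf
  | succ n ih =>
    intro x hx
    have hxm : (x : ℂ) ∈ Metric.ball (0 : ℂ) ρ := by simpa using hx
    have hA : AnalyticAt ℂ (iteratedDeriv n F) x := by
      rw [iteratedDeriv_eq_iterate]
      exact AnalyticAt.iterated_deriv (hF.analyticAt (Metric.isOpen_ball.mem_nhds hxm)) n
    have hev : iteratedDeriv n f =ᶠ[𝓝 x] fun y : ℝ => (iteratedDeriv n F y).re := by
      filter_upwards [(isOpen_lt continuous_abs continuous_const).mem_nhds hx] with y hy
      exact ih y hy
    rw [iteratedDeriv_succ, iteratedDeriv_succ, hev.deriv_eq]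
    exact hA.differentiableAt.hasDerivAt.real_of_complex.deriv

/-- Cauchy's coefficient formula, as an integral over `[-π, π]`. -/
theorem iteratedDeriv_div_factorial_eq_integral {F : ℂ → ℂ} {s : ℝ} (hs : 0 < s)
    (hF : DifferentiableOn ℂ F (Metric.closedBall 0 s)) (n : ℕ) :
    iteratedDeriv n F 0 / (n.factorial : ℂ) = (2 * Real.pi : ℂ)⁻¹ * ((s : ℂ) ^ n)⁻¹ *
      ∫ φ in (-Real.pi)..Real.pi,
        F (s * Complex.exp (φ * Complex.I)) * Complex.exp (-(φ * Complex.I * n)) := by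
  have hc := hF.circleIntegral_one_div_sub_center_pow_smul hs n
  have hs' : (s : ℂ) ≠ 0 := by exact_mod_cast hs.ne'
  have hpi : (Real.pi : ℂ) ≠ 0 := by exact_mod_cast Real.pi_ne_zero
  have hn : (n.factorial : ℂ) ≠ 0 := by exact_mod_cast n.factorial_ne_zero
  set h : ℝ → ℂ := fun φ =>
    F (s * Complex.exp (φ * Complex.I)) * Complex.exp (-(φ * Complex.I * n)) with hh
  have hper : Function.Periodic h (2 * Real.pi) := by
    intro φ
    have h1 : Complex.exp (((φ + 2 * Real.pi : ℝ) : ℂ) * Complex.I)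
        = Complex.exp (φ * Complex.I) := by
      push_cast
      rw [add_mul, Complex.exp_add, Complex.exp_two_pi_mul_I, mul_one]
    have h2 (x : ℝ) : Complex.exp (-((x : ℂ) * Complex.I * n))
        = (Complex.exp (x * Complex.I) ^ n)⁻¹ := by
      rw [Complex.exp_neg, ← Complex.exp_nat_mul, mul_comm (n : ℂ)]
    simp only [hh, h2, h1]
  have hshift : ∫ φ in (0 : ℝ)..2 * Real.pi, h φ = ∫ φ in (-Real.pi)..Real.pi, h φ := by
    have := hper.intervalIntegral_add_eq 0 (-Real.pi)
    rwa [zero_add, show -Real.pi + 2 * Real.pi = Real.pi by ring] at this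
  have hint : (∮ z in C(0, s), (1 / (z - 0) ^ (n + 1)) • F z)
      = Complex.I * ((s : ℂ) ^ n)⁻¹ * ∫ φ in (0 : ℝ)..2 * Real.pi, h φ := by
    rw [circleIntegral, ← intervalIntegral.integral_const_mul]
    refine intervalIntegral.integral_congr fun φ _ => ?_
    simp only [hh, deriv_circleMap, circleMap, zero_add, sub_zero, smul_eq_mul]
    rw [Complex.exp_neg, mul_comm _ (n : ℂ), Complex.exp_nat_mul, mul_pow]
    have := Complex.exp_ne_zero (φ * Complex.I)
    field_simp
    ring
  rw [← hshift]
  rw [hint, smul_eq_mul] at hc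
  field_simp at hc ⊢
  linear_combination -hc

theorem sqrt_mul_integral_exp_neg_sq_tendsto {ι : Type*} {l : Filter ι} [l.IsCountablyGenerated]
    {B : ι → ℝ} (hB : Tendsto B l atTop) :
    Tendsto (fun n => √(B n) * ∫ φ in (-Real.pi)..Real.pi, Real.exp (-(φ ^ 2 / 2) * B n)) l
      (𝓝 √(2 * Real.pi)) := by
  have hsq : Tendsto (fun n => √(B n)) l atTop := Real.tendsto_sqrt_atTop.comp hB
  have hlim := MeasureTheory.intervalIntegral_tendsto_integral
    (integrable_exp_neg_mul_sq (b := 1 / 2) (by norm_num))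
    (tendsto_neg_atTop_atBot.comp (hsq.atTop_mul_const Real.pi_pos))
    (hsq.atTop_mul_const Real.pi_pos)
  rw [integral_gaussian, show Real.pi / (1 / 2) = 2 * Real.pi by ring] at hlim
  refine hlim.congr' ?_
  filter_upwards [hB.eventually_gt_atTop 0] with n hn
  have := intervalIntegral.mul_integral_comp_mul_right (a := -Real.pi) (b := Real.pi)
    (f := fun x => Real.exp (-(1 / 2) * x ^ 2)) (√(B n))
  simp only [Function.comp_apply]
  rw [mul_comm (√(B n)) Real.pi, ← neg_mul, ← this]
  congr 1
  refine intervalIntegral.integral_congr fun φ _ => ?_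
  simp only [mul_pow, Real.sq_sqrt hn.le]
  congr 1
  ring

/-- Pointwise comparison of an integrand with a Gaussian, from its behaviour on
`|φ| ≤ d` and on `d < |φ|`. -/
theorem norm_sub_exp_neg_sq_le {h R : ℝ → ℂ} {B d ε φ : ℝ} (hB : 0 ≤ B) (hd : 0 ≤ d)
    (hε : 0 ≤ ε)
    (hminor : |φ| ≤ d → h φ = Complex.exp ((-(φ ^ 2 / 2) * B : ℝ) + R φ) ∧ ‖R φ‖ ≤ ε)
    (hmajor : d < |φ| → ‖h φ‖ ≤ Real.exp (-(d ^ 2 / 2) * B + ε)) :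
    ‖h φ - (Real.exp (-(φ ^ 2 / 2) * B) : ℝ)‖
      ≤ (Real.exp ε - 1) * Real.exp (-(φ ^ 2 / 2) * B)
        + (Real.exp ε + 1) * Real.exp (-(d ^ 2 / 2) * B) := by
  have h1 : 0 ≤ Real.exp ε - 1 := by linarith [Real.one_le_exp hε]
  rcases le_or_gt |φ| d with hφ | hφ
  · obtain ⟨he, hR⟩ := hminor hφ
    have h2 : ‖h φ - (Real.exp (-(φ ^ 2 / 2) * B) : ℝ)‖
        = ‖Complex.exp (R φ) - 1‖ * Real.exp (-(φ ^ 2 / 2) * B) := by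
      rw [he, Complex.exp_add, Complex.ofReal_exp, ← mul_sub_one, norm_mul, mul_comm,
        Complex.norm_exp_ofReal]
    have h3 : ‖Complex.exp (R φ) - 1‖ ≤ Real.exp ε - 1 := by
      have := Complex.norm_exp_sub_sum_le_exp_norm_sub_sum (R φ) 1
      simp only [Finset.sum_range_one, pow_zero, Nat.factorial_zero, Nat.cast_one, div_one] at this
      linarith [Real.exp_le_exp.mpr hR]
    rw [h2]
    have := mul_le_mul_of_nonneg_right h3 (Real.exp_pos (-(φ ^ 2 / 2) * B)).le
    have : 0 ≤ (Real.exp ε + 1) * Real.exp (-(d ^ 2 / 2) * B) := by positivity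
    linarith
  · have h2 : Real.exp (-(φ ^ 2 / 2) * B) ≤ Real.exp (-(d ^ 2 / 2) * B) := by
      have : d ^ 2 ≤ φ ^ 2 := by
        rw [← sq_abs φ]
        gcongr
      gcongr
    have h3 := norm_sub_le (h φ) (Real.exp (-(φ ^ 2 / 2) * B) : ℝ)
    rw [Complex.norm_real, Real.norm_of_nonneg (Real.exp_pos _).le] at h3
    have h4 := hmajor hφ
    rw [Real.exp_add] at h4
    have := mul_nonneg h1 (Real.exp_pos (-(φ ^ 2 / 2) * B)).le
    linarith

theorem sqrt_mul_exp_neg_tendsto_zero {ι : Type*} {l : Filter ι} {B d : ι → ℝ}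
    (hB : Tendsto B l atTop)
    (hw : Tendsto (fun n => d n ^ 2 * B n - Real.log (B n)) l atTop) :
    Tendsto (fun n => √(B n) * Real.exp (-(d n ^ 2 / 2) * B n)) l (𝓝 0) := by
  have hlim := Real.tendsto_exp_atBot.comp
    (tendsto_neg_atTop_atBot.comp (hw.atTop_div_const (r := 2) two_pos))
  refine hlim.congr' ?_
  filter_upwards [hB.eventually_gt_atTop 0] with n hn
  simp only [Function.comp_apply]
  rw [← Real.exp_log (Real.sqrt_pos.mpr hn), ← Real.exp_add, Real.log_sqrt hn.le]
  congr 1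
  ring

/-- Laplace's method on `[-π, π]`. -/
theorem sqrt_mul_integral_tendsto {h R : ℕ → ℝ → ℂ} {B d ε : ℕ → ℝ}
    (hB : Tendsto B atTop atTop) (hd : ∀ n, 0 ≤ d n) (hε : ∀ n, 0 ≤ ε n)
    (hε0 : Tendsto ε atTop (𝓝 0))
    (hw : Tendsto (fun n => d n ^ 2 * B n - Real.log (B n)) atTop atTop)
    (hcont : ∀ n, Continuous (h n))
    (hminor : ∀ n φ, |φ| ≤ d n →
      h n φ = Complex.exp ((-(φ ^ 2 / 2) * B n : ℝ) + R n φ) ∧ ‖R n φ‖ ≤ ε n)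
    (hmajor : ∀ n φ, |φ| ≤ Real.pi → d n < |φ| →
      ‖h n φ‖ ≤ Real.exp (-(d n ^ 2 / 2) * B n + ε n)) :
    Tendsto (fun n => (√(B n) : ℂ) * ∫ φ in (-Real.pi)..Real.pi, h n φ) atTop
      (𝓝 (√(2 * Real.pi) : ℝ)) := by
  have hG := sqrt_mul_integral_exp_neg_sq_tendsto hB
  have hexp : Tendsto (fun n => Real.exp (ε n)) atTop (𝓝 1) := by
    rw [← Real.exp_zero]
    exact (Real.continuous_exp.tendsto 0).comp hε0
  have hbound : Tendsto (fun n => (Real.exp (ε n) - 1) *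
        (√(B n) * ∫ φ in (-Real.pi)..Real.pi, Real.exp (-(φ ^ 2 / 2) * B n))
      + (Real.exp (ε n) + 1) * (√(B n) * Real.exp (-(d n ^ 2 / 2) * B n)) * (2 * Real.pi))
      atTop (𝓝 0) := by
    have := ((hexp.sub_const 1).mul hG).add
      (((hexp.add_const 1).mul (sqrt_mul_exp_neg_tendsto_zero hB hw)).mul_const (2 * Real.pi))
    simpa using this
  have hdiff : Tendsto (fun n => (√(B n) : ℂ) * (∫ φ in (-Real.pi)..Real.pi, h n φ)
      - ((√(B n) * ∫ φ in (-Real.pi)..Real.pi, Real.exp (-(φ ^ 2 / 2) * B n) : ℝ) : ℂ))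
      atTop (𝓝 0) := by
    refine squeeze_zero_norm' ?_ hbound
    filter_upwards [hB.eventually_ge_atTop 0] with n hn
    have hle : ‖∫ φ in (-Real.pi)..Real.pi,
          (h n φ - (Real.exp (-(φ ^ 2 / 2) * B n) : ℝ))‖
        ≤ ∫ φ in (-Real.pi)..Real.pi, ((Real.exp (ε n) - 1) * Real.exp (-(φ ^ 2 / 2) * B n)
          + (Real.exp (ε n) + 1) * Real.exp (-(d n ^ 2 / 2) * B n)) := by
      refine intervalIntegral.norm_integral_le_of_norm_le (by linarith [Real.pi_pos])
        (Eventually.of_forall fun φ hφ => ?_) (Continuous.intervalIntegrable (by fun_prop) _ _)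
      exact norm_sub_exp_neg_sq_le hn (hd n) (hε n) (hminor n φ)
        (hmajor n φ (abs_le.mpr ⟨hφ.1.le, hφ.2⟩))
    rw [intervalIntegral.integral_sub ((hcont n).intervalIntegrable _ _)
        (Continuous.intervalIntegrable (by fun_prop) _ _),
      intervalIntegral.integral_ofReal,
      intervalIntegral.integral_add (Continuous.intervalIntegrable (by fun_prop) _ _)
        (Continuous.intervalIntegrable (by fun_prop) _ _),
      intervalIntegral.integral_const_mul, intervalIntegral.integral_const, smul_eq_mul] at hle
    rw [Complex.ofReal_mul, ← mul_sub, norm_mul, Complex.norm_real,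
      Real.norm_of_nonneg (Real.sqrt_nonneg _)]
    refine (mul_le_mul_of_nonneg_left hle (Real.sqrt_nonneg _)).trans_eq ?_
    ring
  have := hdiff.add ((Complex.continuous_ofReal.tendsto _).comp hG)
  simpa using this

/-- Theorem 4.5, saddle point method: if `(g_n)` is a log-n-admissible
sequence of power series with non-negative coefficients, then
`G_n = [t^n] exp(g_n(t)) = (2π)^{-1/2} r_n^{-n} b_n(r_n)^{-1/2} exp(g_n(r_n)) (1+o(1))`. -/
theorem saddle_point_asymptotics
    (ρ : ℝ) (hρ : 0 < ρ)
    (gc : ℕ → ℕ → ℝ) (hgc : ∀ n k, 0 ≤ gc n k)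
    (hconv : ∀ n : ℕ, ∀ r : ℝ, |r| < ρ → Summable fun k => gc n k * r ^ k)
    (g : ℕ → ℝ → ℝ) (hg : ∀ n r, g n r = ∑' k : ℕ, gc n k * r ^ k)
    (gC : ℕ → ℂ → ℂ) (hgC : ∀ n z, gC n z = ∑' k : ℕ, (gc n k : ℂ) * z ^ k)
    -- `a_n(r) = r g_n'(r)` and `b_n(r) = r g_n'(r) + r² g_n''(r)`
    (a b : ℕ → ℝ → ℝ)
    (ha : ∀ n r, a n r = r * deriv (g n) r)
    (hb : ∀ n r, b n r = r * deriv (g n) r + r ^ 2 * deriv (deriv (g n)) r)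
    -- saddle point
    (r : ℕ → ℝ) (hr : ∀ n, 0 ≤ r n ∧ r n < ρ)
    (hsaddle : ∀ n, a n (r n) = n)
    -- divergence and width of convergence
    (δ : ℕ → ℝ) (hδpos : ∀ n, 0 < δ n) (hδ0 : Tendsto δ atTop (nhds 0))
    (hbdiv : Tendsto (fun n => b n (r n)) atTop atTop)
    (hwidth : Tendsto (fun n => δ n ^ 2 * b n (r n) - Real.log (b n (r n))) atTop atTop)
    -- approximation on the minor arc, with error `R_n(r_n,φ) = o(φ³ δ_n^{-3})`
    (R : ℕ → ℝ → ℂ)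
    (happrox : ∀ n : ℕ, ∀ φ : ℝ, |φ| ≤ δ n →
      gC n ((r n : ℂ) * Complex.exp ((φ : ℂ) * Complex.I))
        = gC n (r n) + (φ : ℂ) * Complex.I * (a n (r n) : ℂ)
          - (φ : ℂ) ^ 2 / 2 * (b n (r n) : ℂ) + R n φ)
    (hR : ∃ ε : ℕ → ℝ, Tendsto ε atTop (nhds 0) ∧
      ∀ n : ℕ, ∀ φ : ℝ, |φ| ≤ δ n → ‖R n φ‖ ≤ ε n * |φ| ^ 3 * ((δ n) ^ 3)⁻¹)
    -- monotonicity on the major arc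
    (hmono : ∀ n : ℕ, ∀ φ : ℝ, δ n < |φ| → |φ| ≤ Real.pi →
      (gC n ((r n : ℂ) * Complex.exp ((φ : ℂ) * Complex.I))).re
        ≤ (gC n ((r n : ℂ) * Complex.exp ((Real.sign φ * δ n : ℝ) * Complex.I))).re) :
    ∃ e : ℕ → ℝ, Tendsto e atTop (nhds 0) ∧
      ∀ᶠ n in atTop,
        iteratedDeriv n (fun u => Real.exp (g n u)) 0 / (Nat.factorial n : ℝ)
          = (Real.sqrt (2 * Real.pi))⁻¹ * (r n ^ n)⁻¹ * (Real.sqrt (b n (r n)))⁻¹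
              * Real.exp (g n (r n)) * (1 + e n) := by
  obtain ⟨ε, hε0, hRε⟩ := hR
  have hgC_eq (n : ℕ) : gC n = fun z : ℂ => ∑' k, (gc n k : ℂ) * z ^ k := funext (hgC n)
  have hdiff (n : ℕ) : DifferentiableOn ℂ (gC n) (Metric.ball 0 ρ) := by
    rw [hgC_eq n]
    exact differentiableOn_tsum_ofReal_mul_pow (hgc n) (hconv n)
  have hgreal (n : ℕ) (x : ℝ) : gC n x = (g n x : ℂ) := by
    rw [hgC, hg, Complex.ofReal_tsum]
    push_cast
    rfl
  have hmem (n : ℕ) (φ : ℝ) :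
      (r n : ℂ) * Complex.exp (φ * Complex.I) ∈ Metric.ball (0 : ℂ) ρ := by
    rw [mem_ball_zero_iff, norm_mul, Complex.norm_exp_ofReal_mul_I, mul_one, Complex.norm_real,
      Real.norm_of_nonneg (hr n).1]
    exact (hr n).2
  have hRabs (n : ℕ) (φ : ℝ) (hφ : |φ| ≤ δ n) : ‖R n φ‖ ≤ |ε n| := by
    have hδ := hδpos n
    have h1 : |φ| ^ 3 * (δ n ^ 3)⁻¹ ≤ 1 := by
      rw [← div_eq_mul_inv]
      exact div_le_one_of_le₀ (by gcongr) (by positivity)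
    calc ‖R n φ‖ ≤ ε n * |φ| ^ 3 * (δ n ^ 3)⁻¹ := hRε n φ hφ
      _ = ε n * (|φ| ^ 3 * (δ n ^ 3)⁻¹) := mul_assoc _ _ _
      _ ≤ |ε n| * (|φ| ^ 3 * (δ n ^ 3)⁻¹) := by
        gcongr
        exact le_abs_self _
      _ ≤ |ε n| := mul_le_of_le_one_right (abs_nonneg _) h1
  set h : ℕ → ℝ → ℂ := fun n φ =>
    Complex.exp (gC n ((r n : ℂ) * Complex.exp (φ * Complex.I)) - g n (r n)
      - φ * Complex.I * n) with hh
  have hcont (n : ℕ) : Continuous (h n) := by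
    have : Continuous fun φ : ℝ => gC n ((r n : ℂ) * Complex.exp (φ * Complex.I)) :=
      (hdiff n).continuousOn.comp_continuous (by fun_prop) (hmem n)
    exact ((this.sub continuous_const).sub (by fun_prop)).cexp
  have hminor (n : ℕ) (φ : ℝ) (hφ : |φ| ≤ δ n) :
      h n φ = Complex.exp ((-(φ ^ 2 / 2) * b n (r n) : ℝ) + R n φ) ∧ ‖R n φ‖ ≤ |ε n| := by
    refine ⟨?_, hRabs n φ hφ⟩
    simp only [hh]
    rw [happrox n φ hφ, hsaddle, hgreal]
    congr 1
    push_cast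
    ring
  have hmajor (n : ℕ) (φ : ℝ) (hφ : |φ| ≤ Real.pi) (hδφ : δ n < |φ|) :
      ‖h n φ‖ ≤ Real.exp (-(δ n ^ 2 / 2) * b n (r n) + |ε n|) := by
    have hφ0 : φ ≠ 0 := by
      rintro rfl
      have := hδpos n
      simp at hδφ
      linarith
    have hsq : (Real.sign φ * δ n) ^ 2 = δ n ^ 2 := by
      rcases Real.sign_apply_eq_of_ne_zero φ hφ0 with hs | hs <;> rw [hs] <;> ring
    have hle : |Real.sign φ * δ n| ≤ δ n :=
      (sq_eq_sq_iff_abs_eq_abs _ _ |>.mp hsq).trans (abs_of_pos (hδpos n)) |>.le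
    have hm := hmono n φ hδφ hφ
    have hnorm (ψ : ℝ) : ‖h n ψ‖ = Real.exp
        ((gC n ((r n : ℂ) * Complex.exp (ψ * Complex.I))).re - g n (r n)) := by
      simp [hh, Complex.norm_exp]
    have hend := (hminor n _ hle).1
    calc ‖h n φ‖ ≤ ‖h n (Real.sign φ * δ n)‖ := by
          rw [hnorm, hnorm]
          gcongr
      _ ≤ _ := by
          rw [hend, Complex.norm_exp, Complex.add_re, Complex.ofReal_re, hsq]
          gcongr
          exact (Complex.re_le_norm _).trans (hRabs n _ hle)
  have hlim := sqrt_mul_integral_tendsto hbdiv (fun n => (hδpos n).le) (fun n => abs_nonneg (ε n))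
    (by simpa using hε0.abs) hwidth hcont hminor hmajor
  have hre := (Complex.continuous_re.tendsto _).comp hlim
  rw [Complex.ofReal_re] at hre
  have h2pi : 0 < √(2 * Real.pi) := Real.sqrt_pos.mpr Real.two_pi_pos
  refine ⟨fun n => √(b n (r n)) * (∫ φ in (-Real.pi)..Real.pi, h n φ).re / √(2 * Real.pi) - 1,
    ?_, ?_⟩
  · have := (hre.div_const √(2 * Real.pi)).sub_const 1
    rw [div_self h2pi.ne', sub_self] at this
    refine this.congr fun n => ?_
    simp
  · filter_upwards [hbdiv.eventually_gt_atTop 0, eventually_ge_atTop 1] with n hbn hn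
    have hrpos : 0 < r n := by
      refine (hr n).1.lt_of_ne fun h0 => ?_
      have := hsaddle n
      rw [ha, ← h0, zero_mul] at this
      have : n = 0 := by exact_mod_cast this.symm
      omega
    have hFd : DifferentiableOn ℂ (fun z => Complex.exp (gC n z)) (Metric.ball 0 ρ) :=
      (hdiff n).cexp
    have hcoef := iteratedDeriv_eq_re_of_differentiableOn hFd (f := fun u => Real.exp (g n u))
      (fun x _ => by rw [hgreal, ← Complex.ofReal_exp, Complex.ofReal_re]) n 0 (by simpa using hρ)
    have hcauchy := iteratedDeriv_div_factorial_eq_integral hrpos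
      (hFd.mono (Metric.closedBall_subset_ball (hr n).2)) n
    have hint : (∫ φ in (-Real.pi)..Real.pi,
          Complex.exp (gC n (r n * Complex.exp (φ * Complex.I)))
            * Complex.exp (-(φ * Complex.I * n)))
        = (Real.exp (g n (r n)) : ℝ) * ∫ φ in (-Real.pi)..Real.pi, h n φ := by
      rw [← intervalIntegral.integral_const_mul]
      refine intervalIntegral.integral_congr fun φ _ => ?_
      simp only [hh]
      rw [Complex.ofReal_exp, ← Complex.exp_add, ← Complex.exp_add]
      congr 1
      ring
    have hmain : iteratedDeriv n (fun u => Real.exp (g n u)) 0 / (n.factorial : ℝ)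
        = (2 * Real.pi)⁻¹ * (r n ^ n)⁻¹ * Real.exp (g n (r n))
          * (∫ φ in (-Real.pi)..Real.pi, h n φ).re := by
      have h1 := congrArg Complex.re hcauchy
      rw [hint, ← mul_assoc,
        show (2 * Real.pi : ℂ)⁻¹ * ((r n : ℂ) ^ n)⁻¹ * (Real.exp (g n (r n)) : ℝ)
          = (((2 * Real.pi)⁻¹ * (r n ^ n)⁻¹ * Real.exp (g n (r n)) : ℝ) : ℂ) by push_cast; rfl,
        Complex.re_ofReal_mul, Complex.div_natCast_re] at h1
      rw [hcoef, Complex.ofReal_zero, h1]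
    have hbs : √(b n (r n)) ≠ 0 := (Real.sqrt_pos.mpr hbn).ne'
    have hpi2 : (2 * Real.pi)⁻¹ = (√(2 * Real.pi))⁻¹ * (√(2 * Real.pi))⁻¹ := by
      rw [← mul_inv, Real.mul_self_sqrt Real.two_pi_pos.le]
    rw [hmain, hpi2]
    have h2pi' := h2pi.ne'
    field_simp
    ring
end
end
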